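/- Let Γ and Λ be finite connected simplicial graphs, each with at least two vertices. Suppose Γ has a cut vertex, Γ is not equal to star(u) for any vertex u of Γ, and every subgraph in C₁ of Γ is a clique (so that every rigid vertex group of the JSJ tree-of-cylinders decomposition of A(Γ) is free abelian). If A(Γ) and A(Λ) are quasi-isometric, then Λ has a cut vertex, Λ is not equal to star(u) for any vertex u of Λ, and every subgraph in C₁ of Λ is a clique. -/

import Mathlib

noncomputable section

universe u v

/-- Word metric (distance function) on a group with respect to a generating set `S`. -/
def wordDist {G : Type*} [Group G] (S : Set G) (g h : G) : ℝ :=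
  sInf ((fun l : List G => (l.length : ℝ)) ''
    {l : List G | (∀ x ∈ l, x ∈ S ∨ x⁻¹ ∈ S) ∧ g * l.prod = h})

/-- `f` is `(K, A)`-coarse Lipschitz. -/
def CoarseLipschitzWith {X Y : Type*} (K A : ℝ) (dX : X → X → ℝ) (dY : Y → Y → ℝ)
    (f : X → Y) : Prop :=
  ∀ x x', dY (f x) (f x') ≤ K * dX x x' + A

/-- `f` is a `(K, A)`-quasi-isometry. -/
def IsQIWith {X Y : Type*} (K A : ℝ) (dX : X → X → ℝ) (dY : Y → Y → ℝ) (f : X → Y) : Prop :=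
  1 ≤ K ∧ 0 ≤ A ∧
  (∀ x x', dX x x' / K - A ≤ dY (f x) (f x') ∧ dY (f x) (f x') ≤ K * dX x x' + A) ∧
  (∀ y, ∃ x, dY (f x) y ≤ A)

/-- `f` is a quasi-isometry. -/
def IsQI {X Y : Type*} (dX : X → X → ℝ) (dY : Y → Y → ℝ) (f : X → Y) : Prop :=
  ∃ K A : ℝ, IsQIWith K A dX dY f

/-- The Hausdorff distance between `S` and `T` (w.r.t. the distance `d`) is at most `r`. -/
def HausLE {X : Type*} (d : X → X → ℝ) (S T : Set X) (r : ℝ) : Prop :=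
  (∀ s ∈ S, ∃ t ∈ T, d s t ≤ r) ∧ (∀ t ∈ T, ∃ s ∈ S, d s t ≤ r)

/-- `S` and `T` are at finite Hausdorff distance. -/
def FinHaus {X : Type*} (d : X → X → ℝ) (S T : Set X) : Prop :=
  ∃ r : ℝ, 0 ≤ r ∧ HausLE d S T r

/-- The commutator relations of a right-angled Artin group. -/
def raagRels {V : Type} (Γ : SimpleGraph V) : Set (FreeGroup V) :=
  {r | ∃ x y : V, Γ.Adj x y ∧
    r = FreeGroup.of x * FreeGroup.of y * (FreeGroup.of x)⁻¹ * (FreeGroup.of y)⁻¹}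

/-- The right-angled Artin group `A(Γ)` of a simplicial graph `Γ`. -/
abbrev Raag {V : Type} (Γ : SimpleGraph V) : Type := PresentedGroup (raagRels Γ)

/-- The generator of `Raag Γ` corresponding to a vertex. -/
def raagGen {V : Type} (Γ : SimpleGraph V) (x : V) : Raag Γ :=
  PresentedGroup.of (rels := raagRels Γ) x

/-- The word metric on `Raag Γ` with respect to the vertex generators. -/
def raagDist {V : Type} (Γ : SimpleGraph V) : Raag Γ → Raag Γ → ℝ :=
  wordDist (Set.range (raagGen Γ))

/-- `A(Γ)` and `A(Λ)` are quasi-isometric (w.r.t. the vertex word metrics). -/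
def RaagQI {V W : Type} (Γ : SimpleGraph V) (Λ : SimpleGraph W) : Prop :=
  ∃ f : Raag Γ → Raag Λ, IsQI (raagDist Γ) (raagDist Λ) f

/-- A standard geodesic: the coset `g⟨v⟩`, recorded by a basepoint `g` and a label `v`. -/
structure StdGeod {V : Type} (Γ : SimpleGraph V) where
  base : Raag Γ
  label : V

/-- The parametrization `n ↦ g vⁿ` of a standard geodesic, identifying it with `ℤ`. -/
def StdGeod.param {V : Type} {Γ : SimpleGraph V} (l : StdGeod Γ) : ℤ → Raag Γ :=
  fun n => l.base * raagGen Γ l.label ^ n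

/-- The underlying subset of a standard geodesic. -/
def StdGeod.carrier {V : Type} {Γ : SimpleGraph V} (l : StdGeod Γ) : Set (Raag Γ) :=
  Set.range l.param

/-- Two standard geodesics are parallel if they are at finite Hausdorff distance. -/
def Parallel {V : Type} {Γ : SimpleGraph V} (l k : StdGeod Γ) : Prop :=
  FinHaus (raagDist Γ) l.carrier k.carrier

/-- A based quasi-isometry `(A(Γ), l) → (A(Λ), l')`. -/
def IsBasedQI {V W : Type} {Γ : SimpleGraph V} {Λ : SimpleGraph W}
    (f : Raag Γ → Raag Λ) (l : StdGeod Γ) (l' : StdGeod Λ) : Prop :=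
  IsQI (raagDist Γ) (raagDist Λ) f ∧ FinHaus (raagDist Λ) (f '' l.carrier) l'.carrier

/-- `str(f, l, C) = r`: on `l`, the map `f` is `C`-close to `n ↦ ±⌊r n⌋ + b`
(read through the identifications of `l` and `l'` with `ℤ`). -/
def StrWith {V W : Type} {Γ : SimpleGraph V} {Λ : SimpleGraph W}
    (f : Raag Γ → Raag Λ) (l : StdGeod Γ) (l' : StdGeod Λ) (C : ℝ) (r : ℚ) : Prop :=
  ∃ ε : ℤ, (ε = 1 ∨ ε = -1) ∧ ∃ b : ℤ,
    ∀ n : ℤ, raagDist Λ (f (l.param n)) (l'.param (ε * ⌊r * (n : ℚ)⌋ + b)) ≤ C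

/-- The stretch factor `str(f, l)` (computed with respect to `l'`) is well-defined
and equals `r`. -/
def HasStr {V W : Type} {Γ : SimpleGraph V} {Λ : SimpleGraph W}
    (f : Raag Γ → Raag Λ) (l : StdGeod Γ) (l' : StdGeod Λ) (r : ℚ) : Prop :=
  ∃ C : ℝ, 0 ≤ C ∧ StrWith f l l' C r

/-- `l` is an `𝓡`-geodesic. -/
def IsRGeod {V : Type} {Γ : SimpleGraph V} (l : StdGeod Γ) : Prop :=
  ∀ (W : Type) [Fintype W] (Λ : SimpleGraph W) (l' : StdGeod Λ)
    (f g : Raag Γ → Raag Λ),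
    IsBasedQI f l l' → IsBasedQI g l l' →
    ∃ r : ℚ, HasStr f l l' r ∧ HasStr g l l' r

/-- The parallelism class `𝒮_l` of a standard geodesic (as a family of subsets). -/
def parClass {V : Type} {Γ : SimpleGraph V} (l : StdGeod Γ) : Set (Set (Raag Γ)) :=
  {S | ∃ k : StdGeod Γ, S = k.carrier ∧ Parallel l k}

/-- The peripheral structure `𝒫_B` on `Raag Γ` determined by a set `B` of vertices. -/
def periph {V : Type} (Γ : SimpleGraph V) (B : Set V) : Set (Set (Set (Raag Γ))) :=
  {F | ∃ l : StdGeod Γ, l.label ∈ B ∧ F = parClass l}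

/-- A `(K, A)`-relative quasi-isometry between spaces with peripheral structures. -/
def IsRelQIWith {X Y : Type*} (K A : ℝ) (dX : X → X → ℝ) (dY : Y → Y → ℝ)
    (PX : Set (Set (Set X))) (PY : Set (Set (Set Y)))
    (f : X → Y) (fs : Set (Set X) → Set (Set Y)) : Prop :=
  IsQIWith K A dX dY f ∧
  Set.BijOn fs PX PY ∧
  ∀ F ∈ PX, (∀ a ∈ F, ∃ b ∈ fs F, HausLE dY (f '' a) b A) ∧
            (∀ b ∈ fs F, ∃ a ∈ F, HausLE dY (f '' a) b A)

/-- The two spaces with peripheral structures are relatively quasi-isometric. -/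
def IsRelQI {X Y : Type*} (dX : X → X → ℝ) (dY : Y → Y → ℝ)
    (PX : Set (Set (Set X))) (PY : Set (Set (Set Y))) : Prop :=
  ∃ (K A : ℝ) (f : X → Y) (fs : Set (Set X) → Set (Set Y)),
    IsRelQIWith K A dX dY PX PY f fs

/-- Left translation of a family of subsets of `Raag Γ`. -/
def translateFam {V : Type} {Γ : SimpleGraph V} (g : Raag Γ) (F : Set (Set (Raag Γ))) :
    Set (Set (Raag Γ)) :=
  (fun a => (fun x => g * x) '' a) '' F

/-- A decoration on `𝒫_B` that is invariant under the left translation action. -/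
def DecorInvariant {V : Type} (Γ : SimpleGraph V) (B : Set V) {O : Type}
    (δ : Set (Set (Raag Γ)) → O) : Prop :=
  ∀ g : Raag Γ, ∀ F ∈ periph Γ B, δ (translateFam g F) = δ F

/-- A decoration-preserving based relative quasi-isometry
`(A(Γ), 𝒫_{BΓ}, δΓ, l) → (A(Λ), 𝒫_{BΛ}, δΛ, l')`. -/
def IsDecorBasedRelQI {V W : Type} (Γ : SimpleGraph V) (Λ : SimpleGraph W)
    (BΓ : Set V) (BΛ : Set W) {O : Type}
    (δΓ : Set (Set (Raag Γ)) → O) (δΛ : Set (Set (Raag Λ)) → O)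
    (l : StdGeod Γ) (l' : StdGeod Λ)
    (f : Raag Γ → Raag Λ) (fs : Set (Set (Raag Γ)) → Set (Set (Raag Λ))) : Prop :=
  (∃ K A : ℝ, IsRelQIWith K A (raagDist Γ) (raagDist Λ) (periph Γ BΓ) (periph Λ BΛ) f fs) ∧
  (∀ F ∈ periph Γ BΓ, δΛ (fs F) = δΓ F) ∧
  FinHaus (raagDist Λ) (f '' l.carrier) l'.carrier

/-- `A(Γ)` is a dovetail RAAG. -/
def Dovetail {V : Type} (Γ : SimpleGraph V) : Prop :=
  ∀ (W : Type) [Fintype W] (Λ : SimpleGraph W) (BΓ : Set V) (BΛ : Set W)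
    (O : Type) (δΓ : Set (Set (Raag Γ)) → O) (δΛ : Set (Set (Raag Λ)) → O),
    DecorInvariant Γ BΓ δΓ → DecorInvariant Λ BΛ δΛ →
    ∀ (l : StdGeod Γ) (l' : StdGeod Λ) (f : Raag Γ → Raag Λ)
      (fs : Set (Set (Raag Γ)) → Set (Set (Raag Λ))),
      IsDecorBasedRelQI Γ Λ BΓ BΛ δΓ δΛ l l' f fs →
      ∀ lam : Set (Set (Raag Γ)) → ℚ,
        (∀ F ∈ periph Γ BΓ, 0 < lam F) →
        (∃ M : ℚ, 1 ≤ M ∧ ∀ F ∈ periph Γ BΓ, 1 / M ≤ lam F ∧ lam F ≤ M) →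
        (∀ F ∈ periph Γ BΓ, ∀ F' ∈ periph Γ BΓ, δΓ F = δΓ F' → lam F = lam F') →
        ∃ C : ℝ, 0 ≤ C ∧
          ∃ (g : Raag Γ → Raag Λ) (gs : Set (Set (Raag Γ)) → Set (Set (Raag Λ))),
            IsDecorBasedRelQI Γ Λ BΓ BΛ δΓ δΛ l l' g gs ∧
            (∀ l2 : StdGeod Γ, l2.label ∈ BΓ → ¬ IsRGeod l2 →
              ∀ l3 : StdGeod Λ, FinHaus (raagDist Λ) (g '' l2.carrier) l3.carrier →
                StrWith g l2 l3 C (lam (parClass l2))) ∧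
            (∀ l2 : StdGeod Γ, l2.label ∈ BΓ → IsRGeod l2 →
              ∀ l3 : StdGeod Λ, FinHaus (raagDist Λ) (g '' l2.carrier) l3.carrier →
                ∃ r : ℚ, StrWith g l2 l3 C r)

/-- The closed star of a vertex, as a vertex set. -/
def starSet {V : Type} (Γ : SimpleGraph V) (x : V) : Set V :=
  insert x {u | Γ.Adj x u}

/-- The link of a vertex, as a vertex set. -/
def lkSet {V : Type} (Γ : SimpleGraph V) (x : V) : Set V := {u | Γ.Adj x u}

/-- The link of `x` inside the induced subgraph on `S`. -/
def lkIn {V : Type} (Γ : SimpleGraph V) (S : Set V) (x : V) : Set V :=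
  {u | u ∈ S ∧ Γ.Adj x u}

/-- `x` is a cut vertex: deleting it (and incident edges) disconnects the graph. -/
def CutVertex {V : Type} (Γ : SimpleGraph V) (x : V) : Prop :=
  ¬ (Γ.induce {u : V | u ≠ x}).Preconnected

/-- The vertex set `S` spans a biconnected subgraph: connected with no cut vertex. -/
def Biconn {V : Type} (Γ : SimpleGraph V) (S : Set V) : Prop :=
  (Γ.induce S).Connected ∧ ∀ x ∈ S, (Γ.induce (S \ {x})).Preconnected

/-- `S` spans a maximal biconnected subgraph. -/
def MaxBiconn {V : Type} (Γ : SimpleGraph V) (S : Set V) : Prop :=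
  Biconn Γ S ∧ ∀ T : Set V, Biconn Γ T → S ⊆ T → S = T

/-- The collection `C₁` of maximal biconnected subgraphs: those containing at least
two cut vertices, or not contained in the star of any cut vertex. -/
def C1 {V : Type} (Γ : SimpleGraph V) : Set (Set V) :=
  {S | MaxBiconn Γ S ∧
    ((∃ x ∈ S, ∃ y ∈ S, x ≠ y ∧ CutVertex Γ x ∧ CutVertex Γ y) ∨
     (∀ x : V, CutVertex Γ x → ¬ S ⊆ starSet Γ x))}

/-- `Γ` is an `n`-clique tree-graded graph. -/
def NCliqueTreeGraded {V : Type} (Γ : SimpleGraph V) (n : ℕ) : Prop :=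
  Γ.Connected ∧
  (∀ x : V, CutVertex Γ x ∨ (∃! u : V, Γ.Adj x u)) ∧
  (∃ x y : V, 3 ≤ Γ.dist x y) ∧
  (∀ S : Set V, MaxBiconn Γ S →
    ((Γ.IsClique S ∧ S.ncard = n ∧ ∀ x ∈ S, CutVertex Γ x) ∨
     (Γ.IsClique S ∧ S.ncard = 2 ∧ ∃! x : V, x ∈ S ∧ CutVertex Γ x)))

/-- The subgroup of `Raag Γ` generated by the vertices in `T`. -/
def subRaag {V : Type} (Γ : SimpleGraph V) (T : Set V) : Subgroup (Raag Γ) :=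
  Subgroup.closure (raagGen Γ '' T)

/-- The word metric on the subgroup generated by `T`, w.r.t. the generators from `T`. -/
def subDist {V : Type} (Γ : SimpleGraph V) (T : Set V) :
    ↥(subRaag Γ T) → ↥(subRaag Γ T) → ℝ :=
  wordDist {x : ↥(subRaag Γ T) | ∃ u ∈ T, (x : Raag Γ) = raagGen Γ u}

/-- The cylinder group `A(star(x))`. -/
def cylGroup {V : Type} (Γ : SimpleGraph V) (x : V) : Subgroup (Raag Γ) :=
  subRaag Γ (starSet Γ x)

/-- The word metric on the cylinder `A(star(x))` w.r.t. the vertices of `star(x)`. -/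
def cylDist {V : Type} (Γ : SimpleGraph V) (x : V) :
    ↥(cylGroup Γ x) → ↥(cylGroup Γ x) → ℝ :=
  subDist Γ (starSet Γ x)

/-- The coset `a⟨x⟩`, as a subset of the cylinder `A(star(x))`. -/
def cylCoset {V : Type} (Γ : SimpleGraph V) (x : V) (a : Raag Γ) :
    Set ↥(cylGroup Γ x) :=
  {g | ∃ n : ℤ, (g : Raag Γ) = a * raagGen Γ x ^ n}

/-- The peripheral structure `𝒫_x` on the cylinder `A(star(x))`: one element for each
coset `g·A(star_{Γ'}(x))` with `Γ' ∈ C₁` containing `x`, namely the family of cosets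
`{g·h·⟨x⟩ : h ∈ A(lk_{Γ'}(x))}`. -/
def cylPeriph {V : Type} (Γ : SimpleGraph V) (x : V) :
    Set (Set (Set ↥(cylGroup Γ x))) :=
  {F | ∃ S ∈ C1 Γ, x ∈ S ∧ ∃ g : Raag Γ, g ∈ cylGroup Γ x ∧
    F = {c | ∃ h ∈ subRaag Γ (lkIn Γ S x), c = cylCoset Γ x (g * h)}}

/-- The factors `A(T) ≤ A(Γ)` and `A(T') ≤ A(Λ)` are quasi-isometric. -/
def FactorQI {V W : Type} (Γ : SimpleGraph V) (Λ : SimpleGraph W)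
    (T : Set V) (T' : Set W) : Prop :=
  ∃ φ : ↥(subRaag Γ T) → ↥(subRaag Λ T'), IsQI (subDist Γ T) (subDist Λ T') φ

/-! ### Word length and word distance -/

section WordLength

variable {V : Type} {Γ : SimpleGraph V}

/-- `s` is the generator labelled by `a` or its inverse. -/
def Letter (Γ : SimpleGraph V) (a : V) (s : Raag Γ) : Prop :=
  s = raagGen Γ a ∨ s = (raagGen Γ a)⁻¹

theorem Letter.gen (a : V) : Letter Γ a (raagGen Γ a) := Or.inl rfl

theorem Letter.gen_inv (a : V) : Letter Γ a (raagGen Γ a)⁻¹ := Or.inr rfl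

theorem Letter.inv {a : V} {s : Raag Γ} (h : Letter Γ a s) : Letter Γ a s⁻¹ := by
  rcases h with rfl | rfl
  · exact Or.inr rfl
  · exact Or.inl (inv_inv _)

theorem raagGen_mem_subRaag {T : Set V} {a : V} (ha : a ∈ T) : raagGen Γ a ∈ subRaag Γ T :=
  Subgroup.subset_closure ⟨a, ha, rfl⟩

theorem Letter.mem_subRaag {T : Set V} {a : V} {s : Raag Γ} (h : Letter Γ a s) (ha : a ∈ T) :
    s ∈ subRaag Γ T := by
  rcases h with rfl | rfl
  · exact raagGen_mem_subRaag ha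
  · exact inv_mem (raagGen_mem_subRaag ha)

theorem subRaag_mono {S T : Set V} (h : S ⊆ T) : subRaag Γ S ≤ subRaag Γ T :=
  Subgroup.closure_mono (Set.image_mono h)

theorem subRaag_univ : subRaag Γ Set.univ = ⊤ := by
  rw [subRaag, Set.image_univ]
  exact PresentedGroup.closure_range_of (raagRels Γ)

theorem subRaag_induction {T : Set V} {p : Raag Γ → Prop} (h1 : p 1)
    (hs : ∀ x ∈ subRaag Γ T, ∀ a ∈ T, ∀ s, Letter Γ a s → p x → p (x * s)) :
    ∀ x ∈ subRaag Γ T, p x := by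
  intro x hx
  induction hx using Subgroup.closure_induction_right with
  | one => exact h1
  | mul_right x hx y hy ih =>
    obtain ⟨a, ha, rfl⟩ := hy
    exact hs x hx a ha _ (Letter.gen a) ih
  | mul_inv_cancel x hx y hy ih =>
    obtain ⟨a, ha, rfl⟩ := hy
    exact hs x hx a ha _ (Letter.gen_inv a) ih

theorem raag_induction {p : Raag Γ → Prop} (h1 : p 1)
    (hs : ∀ x a s, Letter Γ a s → p x → p (x * s)) (x : Raag Γ) : p x :=
  subRaag_induction (T := Set.univ) h1 (fun x _ a _ s => hs x a s) x
    (by rw [subRaag_univ]; trivial)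

theorem raagGen_comm {a b : V} (h : Γ.Adj a b) :
    raagGen Γ a * raagGen Γ b = raagGen Γ b * raagGen Γ a := by
  have h1 : (PresentedGroup.mk (raagRels Γ)
      (FreeGroup.of a * FreeGroup.of b * (FreeGroup.of a)⁻¹ * (FreeGroup.of b)⁻¹)) = 1 :=
    PresentedGroup.one_of_mem ⟨a, b, h, rfl⟩
  have h2 : raagGen Γ a * raagGen Γ b * (raagGen Γ a)⁻¹ * (raagGen Γ b)⁻¹ = 1 := by
    simpa [raagGen, PresentedGroup.of] using h1
  have h3 := mul_inv_eq_one.mp h2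
  exact mul_inv_eq_iff_eq_mul.mp h3

theorem Letter.commute {a b : V} {s t : Raag Γ} (hs : Letter Γ a s) (ht : Letter Γ b t)
    (h : Γ.Adj a b ∨ a = b) : Commute s t := by
  have h0 : Commute (raagGen Γ a) (raagGen Γ b) := by
    rcases h with h | rfl
    · exact raagGen_comm h
    · exact Commute.refl _
  rcases hs with rfl | rfl <;> rcases ht with rfl | rfl
  · exact h0
  · exact h0.inv_right
  · exact h0.inv_left
  · exact h0.inv_inv

/-- Word length with respect to the vertex generators. -/
def wlen (x : Raag Γ) : ℕ :=
  sInf {n | ∃ l : List (Raag Γ), (∀ s ∈ l, ∃ a, Letter Γ a s) ∧ l.prod = x ∧ l.length = n}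

theorem exists_word (x : Raag Γ) :
    ∃ l : List (Raag Γ), (∀ s ∈ l, ∃ a, Letter Γ a s) ∧ l.prod = x ∧ l.length = wlen x := by
  have hne : {n | ∃ l : List (Raag Γ), (∀ s ∈ l, ∃ a, Letter Γ a s) ∧ l.prod = x ∧
      l.length = n}.Nonempty := by
    suffices h : ∃ l : List (Raag Γ), (∀ s ∈ l, ∃ a, Letter Γ a s) ∧ l.prod = x by
      obtain ⟨l, h1, h2⟩ := h
      exact ⟨l.length, l, h1, h2, rfl⟩
    induction x using raag_induction with
    | h1 => exact ⟨[], by simp, rfl⟩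
    | hs x a s hs ih =>
      obtain ⟨l, h1, h2⟩ := ih
      refine ⟨l ++ [s], ?_, by simp [h2]⟩
      intro t ht
      rcases List.mem_append.mp ht with ht | ht
      · exact h1 t ht
      · rw [List.mem_singleton] at ht
        exact ⟨a, ht ▸ hs⟩
  exact Nat.sInf_mem hne

theorem wlen_prod_le {l : List (Raag Γ)} (h : ∀ s ∈ l, ∃ a, Letter Γ a s) :
    wlen l.prod ≤ l.length :=
  Nat.sInf_le ⟨l, h, rfl, rfl⟩

theorem wlen_one : wlen (1 : Raag Γ) = 0 :=
  Nat.le_zero.mp (wlen_prod_le (l := ([] : List (Raag Γ))) (by simp))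

theorem Letter.wlen_le {a : V} {s : Raag Γ} (h : Letter Γ a s) : wlen s ≤ 1 := by
  have := wlen_prod_le (l := [s]) (by intro t ht; rw [List.mem_singleton] at ht; exact ⟨a, ht ▸ h⟩)
  simpa using this

theorem wlen_mul_le (x y : Raag Γ) : wlen (x * y) ≤ wlen x + wlen y := by
  obtain ⟨l, h1, h2, h3⟩ := exists_word x
  obtain ⟨m, h4, h5, h6⟩ := exists_word y
  have := wlen_prod_le (l := l ++ m) (by
    intro s hs
    rcases List.mem_append.mp hs with hs | hs
    · exact h1 s hs
    · exact h4 s hs)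
  rw [List.prod_append, List.length_append, h2, h5, h3, h6] at this
  exact this

/-- A function growing by at most one along every edge is bounded by the word length. -/
theorem le_wlen {N : Raag Γ → ℕ} (h1 : N 1 = 0)
    (hs : ∀ x a s, Letter Γ a s → N (x * s) ≤ N x + 1) (x : Raag Γ) : N x ≤ wlen x := by
  obtain ⟨l, h, rfl, h3⟩ := exists_word x
  rw [← h3]
  clear h3
  induction l using List.reverseRecOn with
  | nil => simp [h1]
  | append_singleton l s ih =>
    obtain ⟨a, ha⟩ := h s (by simp)
    have := ih (fun t ht => h t (by simp [ht]))
    have h5 := hs l.prod a s ha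
    simp only [List.prod_append, List.prod_singleton, List.length_append, List.length_singleton]
    omega

theorem wlen_inv_le (x : Raag Γ) : wlen x⁻¹ ≤ wlen x := by
  refine le_wlen (N := fun x => wlen x⁻¹) (by simp [wlen_one]) (fun x a s hs => ?_) x
  have := wlen_mul_le s⁻¹ x⁻¹
  have := hs.inv.wlen_le
  simp only [mul_inv_rev]
  omega

theorem wlen_inv (x : Raag Γ) : wlen x⁻¹ = wlen x :=
  le_antisymm (wlen_inv_le x) (by simpa using wlen_inv_le x⁻¹)

theorem wlen_pow_le (x : Raag Γ) (n : ℕ) : wlen (x ^ n) ≤ n * wlen x := by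
  induction n with
  | zero => simp [wlen_one]
  | succ n ih =>
    have := wlen_mul_le (x ^ n) x
    rw [pow_succ, Nat.succ_mul]
    omega

theorem wlen_zpow_le (x : Raag Γ) (n : ℤ) : wlen (x ^ n) ≤ n.natAbs * wlen x := by
  cases n with
  | ofNat n => simpa using wlen_pow_le x n
  | negSucc n => simpa [zpow_negSucc, wlen_inv] using wlen_pow_le x (n + 1)

theorem Letter.wlen_zpow_le {a : V} {s : Raag Γ} (h : Letter Γ a s) (n : ℤ) :
    wlen (s ^ n) ≤ n.natAbs :=
  (_root_.wlen_zpow_le s n).trans (by simpa using Nat.mul_le_mul_left n.natAbs h.wlen_le)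

theorem wlen_eq_succ {x : Raag Γ} {n : ℕ} (h : wlen x = n + 1) :
    ∃ y a s, Letter Γ a s ∧ wlen y ≤ n ∧ x = y * s := by
  obtain ⟨l, h1, h2, h3⟩ := exists_word x
  induction l using List.reverseRecOn with
  | nil => rw [h] at h3; simp at h3
  | append_singleton l s _ =>
    obtain ⟨a, ha⟩ := h1 s (by simp)
    refine ⟨l.prod, a, s, ha, ?_, by rw [← h2]; simp⟩
    have := wlen_prod_le (l := l) (fun t ht => h1 t (by simp [ht]))
    simp at h3
    omega

theorem eq_one_of_wlen {x : Raag Γ} (h : wlen x = 0) : x = 1 := by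
  obtain ⟨l, h1, h2, h3⟩ := exists_word x
  rw [h, List.length_eq_zero_iff] at h3
  rw [← h2, h3, List.prod_nil]

/-- Word distance. -/
def nd (x y : Raag Γ) : ℕ := wlen (x⁻¹ * y)

theorem nd_self (x : Raag Γ) : nd x x = 0 := by simp [nd, wlen_one]

theorem nd_comm (x y : Raag Γ) : nd x y = nd y x := by
  rw [nd, nd, ← wlen_inv, mul_inv_rev, inv_inv]

theorem nd_triangle (x y z : Raag Γ) : nd x z ≤ nd x y + nd y z := by
  have := wlen_mul_le (x⁻¹ * y) (y⁻¹ * z)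
  simpa [nd, mul_assoc] using this

theorem nd_mul_left (g x y : Raag Γ) : nd (g * x) (g * y) = nd x y := by
  simp [nd, mul_assoc]

theorem nd_one_left (x : Raag Γ) : nd 1 x = wlen x := by simp [nd]

theorem nd_mul_right (x s : Raag Γ) : nd x (x * s) = wlen s := by simp [nd]

theorem nd_letter {a : V} {s : Raag Γ} (h : Letter Γ a s) (x : Raag Γ) : nd x (x * s) ≤ 1 := by
  rw [nd_mul_right]; exact h.wlen_le

theorem eq_of_nd_eq_zero {x y : Raag Γ} (h : nd x y = 0) : x = y := by
  have := eq_one_of_wlen h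
  exact (inv_mul_eq_one.mp this)

theorem raagDist_eq (x y : Raag Γ) : raagDist Γ x y = (nd x y : ℝ) := by
  have key : ∀ l : List (Raag Γ), (∀ s ∈ l, s ∈ Set.range (raagGen Γ) ∨
      s⁻¹ ∈ Set.range (raagGen Γ)) ↔ ∀ s ∈ l, ∃ a, Letter Γ a s := by
    intro l
    refine forall₂_congr fun s _ => ⟨?_, ?_⟩
    · rintro (⟨a, rfl⟩ | ⟨a, h⟩)
      · exact ⟨a, Or.inl rfl⟩
      · exact ⟨a, Or.inr (by rw [h, inv_inv])⟩
    · rintro ⟨a, rfl | rfl⟩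
      · exact Or.inl ⟨a, rfl⟩
      · exact Or.inr ⟨a, (inv_inv _).symm⟩
  apply IsLeast.csInf_eq
  constructor
  · obtain ⟨l, h1, h2, h3⟩ := exists_word (x⁻¹ * y)
    exact ⟨l, ⟨(key l).mpr h1, by rw [h2]; simp⟩, by simp only [h3, nd]⟩
  · rintro _ ⟨l, ⟨h1, h2⟩, rfl⟩
    have h3 := wlen_prod_le ((key l).mp h1)
    have h4 : l.prod = x⁻¹ * y := by rw [← h2]; simp
    rw [h4] at h3
    exact Nat.cast_le.mpr h3

theorem finite_wlen_le [Finite V] (n : ℕ) : {x : Raag Γ | wlen x ≤ n}.Finite := by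
  induction n with
  | zero =>
    refine (Set.finite_singleton (1 : Raag Γ)).subset fun x hx => ?_
    exact eq_one_of_wlen (Nat.le_zero.mp hx)
  | succ n ih =>
    have hf : (Set.range (raagGen Γ) ∪ Set.range fun a => (raagGen Γ a)⁻¹).Finite :=
      (Set.finite_range _).union (Set.finite_range _)
    refine (ih.union (ih.image2 (· * ·) hf)).subset fun x hx => ?_
    rcases Nat.lt_or_ge n (wlen x) with h | h
    · obtain ⟨y, a, s, hs, hy, rfl⟩ := wlen_eq_succ (le_antisymm hx h)
      refine Or.inr ⟨y, hy, s, ?_, rfl⟩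
      rcases hs with rfl | rfl
      · exact Or.inl ⟨a, rfl⟩
      · exact Or.inr ⟨a, rfl⟩
    · exact Or.inl h

theorem finite_ball [Finite V] (x : Raag Γ) (n : ℕ) : {y : Raag Γ | nd x y ≤ n}.Finite := by
  refine ((finite_wlen_le (Γ := Γ) n).image (x * ·)).subset fun y hy => ⟨x⁻¹ * y, hy, by simp⟩

/-- A function that is constant along the edges avoiding `Z` takes the same value at two points
whose distance is smaller than the distance to `Z`. -/
theorem eq_of_far {α : Type*} {c : Raag Γ → α} {Z : Set (Raag Γ)} {x : Raag Γ}
    (hc : ∀ z a s, Letter Γ a s → z ∉ Z → z * s ∉ Z → c (z * s) = c z) {n : ℕ}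
    (hZ : ∀ z ∈ Z, n < nd x z) {y : Raag Γ} (hy : nd x y ≤ n) : c y = c x := by
  induction n generalizing y with
  | zero => rw [eq_of_nd_eq_zero (Nat.le_zero.mp hy)]
  | succ n ih =>
    have ih' := fun (y : Raag Γ) => ih (y := y) fun z hz => (Nat.lt_succ_self n).trans (hZ z hz)
    rcases Nat.lt_or_ge n (nd x y) with h | h
    · obtain ⟨w, a, s, hs, hw, e⟩ := wlen_eq_succ (le_antisymm hy h)
      have hy' : y = x * w * s := by rw [mul_assoc, ← e]; simp
      have hxw : nd x (x * w) ≤ n := by rw [nd_mul_right]; exact hw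
      rw [hy', hc (x * w) a s hs, ih' _ hxw]
      · intro hz; have := hZ _ hz; omega
      · intro hz; rw [← hy'] at hz; have := hZ _ hz; omega
    · exact ih' y h

end WordLength

/-! ### Homomorphisms from a right-angled Artin group -/

section Homs

variable {V : Type} {Γ : SimpleGraph V}

/-- The homomorphism determined by a map on vertices sending adjacent vertices to commuting
elements. -/
def raagLift {G : Type*} [Group G] (φ : V → G) (h : ∀ a b, Γ.Adj a b → Commute (φ a) (φ b)) :
    Raag Γ →* G :=
  PresentedGroup.toGroup (rels := raagRels Γ) (f := φ) (by
    rintro _ ⟨a, b, hab, rfl⟩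
    have := (h a b hab).eq
    simp [this])

theorem raagLift_gen {G : Type*} [Group G] (φ : V → G)
    (h : ∀ a b, Γ.Adj a b → Commute (φ a) (φ b)) (a : V) :
    raagLift φ h (raagGen Γ a) = φ a :=
  PresentedGroup.toGroup.of _

open Classical in
/-- The exponent sum of the generator `b`. -/
def expo (b : V) : Raag Γ →* Multiplicative ℤ :=
  raagLift (fun a => Multiplicative.ofAdd (if a = b then (1 : ℤ) else 0))
    fun _ _ _ => Commute.all _ _

/-- The exponent sum of the generator `b`, as an integer. -/
def expoZ (b : V) (x : Raag Γ) : ℤ := Multiplicative.toAdd (expo b x)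

theorem expoZ_one (b : V) : expoZ b (1 : Raag Γ) = 0 := by simp [expoZ]

theorem expoZ_mul (b : V) (x y : Raag Γ) : expoZ b (x * y) = expoZ b x + expoZ b y := by
  simp [expoZ]

theorem expoZ_inv (b : V) (x : Raag Γ) : expoZ b x⁻¹ = - expoZ b x := by
  simp [expoZ]

theorem expoZ_zpow (b : V) (x : Raag Γ) (n : ℤ) : expoZ b (x ^ n) = n * expoZ b x := by
  simp [expoZ]

theorem expoZ_gen_self (b : V) : expoZ b (raagGen Γ b) = 1 := by
  simp [expoZ, expo, raagLift_gen]

theorem expoZ_gen_ne {a b : V} (h : a ≠ b) : expoZ b (raagGen Γ a) = 0 := by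
  simp [expoZ, expo, raagLift_gen, h]

theorem Letter.expoZ_ne {a b : V} {s : Raag Γ} (hs : Letter Γ a s) (h : a ≠ b) :
    expoZ b s = 0 := by
  rcases hs with rfl | rfl
  · exact expoZ_gen_ne h
  · rw [expoZ_inv, expoZ_gen_ne h, neg_zero]

theorem Letter.expoZ_self {a : V} {s : Raag Γ} (hs : Letter Γ a s) :
    expoZ a s = 1 ∨ expoZ a s = -1 := by
  rcases hs with rfl | rfl
  · exact Or.inl (expoZ_gen_self a)
  · exact Or.inr (by rw [expoZ_inv, expoZ_gen_self])

theorem natAbs_expoZ_le (b : V) (x : Raag Γ) : (expoZ b x).natAbs ≤ wlen x := by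
  refine le_wlen (N := fun x => (expoZ b x).natAbs) (by simp [expoZ_one]) (fun x a s hs => ?_) x
  simp only [expoZ_mul]
  rcases eq_or_ne a b with rfl | h
  · have := hs.expoZ_self
    omega
  · rw [hs.expoZ_ne h]
    omega

theorem natAbs_expoZ_add_le {b c : V} (hbc : b ≠ c) (x : Raag Γ) :
    (expoZ b x).natAbs + (expoZ c x).natAbs ≤ wlen x := by
  refine le_wlen (N := fun x => (expoZ b x).natAbs + (expoZ c x).natAbs)
    (by simp [expoZ_one]) (fun x a s hs => ?_) x
  simp only [expoZ_mul]
  rcases eq_or_ne a b with rfl | h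
  · have := hs.expoZ_self
    have := hs.expoZ_ne hbc
    omega
  · have := hs.expoZ_ne h
    rcases eq_or_ne a c with rfl | h'
    · have := hs.expoZ_self
      omega
    · have := hs.expoZ_ne h'
      omega

theorem wlen_gen_zpow (b : V) (n : ℤ) : wlen (raagGen Γ b ^ n) = n.natAbs := by
  refine le_antisymm ((Letter.gen b).wlen_zpow_le n) ?_
  have := natAbs_expoZ_le b (raagGen Γ b ^ n)
  rwa [expoZ_zpow, expoZ_gen_self, mul_one] at this

theorem nd_gen_zpow (g : Raag Γ) (b : V) (m n : ℤ) :
    nd (g * raagGen Γ b ^ m) (g * raagGen Γ b ^ n) = (n - m).natAbs := by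
  rw [nd_mul_left, nd, ← zpow_neg, ← zpow_add, wlen_gen_zpow]
  congr 1
  ring

open Classical in
/-- The endomorphism killing the generators outside `S`. -/
def kill (S : Set V) : Raag Γ →* Raag Γ :=
  raagLift (fun a => if a ∈ S then raagGen Γ a else 1) (by
    intro a b hab
    by_cases ha : a ∈ S <;> by_cases hb : b ∈ S <;> simp [ha, hb]
    exact raagGen_comm hab)

theorem kill_gen_mem {S : Set V} {a : V} (h : a ∈ S) : kill S (raagGen Γ a) = raagGen Γ a := by
  simp [kill, raagLift_gen, h]

theorem kill_gen_not_mem {S : Set V} {a : V} (h : a ∉ S) : kill S (raagGen Γ a) = 1 := by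
  simp [kill, raagLift_gen, h]

theorem Letter.kill_mem {S : Set V} {a : V} {s : Raag Γ} (hs : Letter Γ a s) (h : a ∈ S) :
    kill S s = s := by
  rcases hs with rfl | rfl
  · exact kill_gen_mem h
  · rw [map_inv, kill_gen_mem h]

theorem Letter.kill_not_mem {S : Set V} {a : V} {s : Raag Γ} (hs : Letter Γ a s) (h : a ∉ S) :
    kill S s = 1 := by
  rcases hs with rfl | rfl
  · exact kill_gen_not_mem h
  · rw [map_inv, kill_gen_not_mem h, inv_one]

theorem kill_mem_inter {S T : Set V} {x : Raag Γ} (hx : x ∈ subRaag Γ T) :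
    kill S x ∈ subRaag Γ (S ∩ T) := by
  refine subRaag_induction (p := fun x => kill S x ∈ subRaag Γ (S ∩ T))
    (by rw [map_one]; exact one_mem _) ?_ x hx
  intro x hx a ha s hs ih
  rw [map_mul]
  by_cases h : a ∈ S
  · rw [hs.kill_mem h]
    exact mul_mem ih (hs.mem_subRaag ⟨h, ha⟩)
  · rwa [hs.kill_not_mem h, mul_one]

theorem kill_mem (S : Set V) (x : Raag Γ) : kill S x ∈ subRaag Γ S := by
  have := kill_mem_inter (S := S) (T := Set.univ) (x := x) (by rw [subRaag_univ]; trivial)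
  rwa [Set.inter_univ] at this

theorem kill_of_mem {S : Set V} {x : Raag Γ} (hx : x ∈ subRaag Γ S) : kill S x = x := by
  refine subRaag_induction (p := fun x => kill S x = x) (map_one _) ?_ x hx
  intro x hx a ha s hs ih
  rw [map_mul, ih, hs.kill_mem ha]

theorem wlen_kill_le (S : Set V) (x : Raag Γ) : wlen (kill S x) ≤ wlen x := by
  refine le_wlen (N := fun x => wlen (kill S x)) (by simp [wlen_one]) (fun x a s hs => ?_) x
  simp only [map_mul]
  by_cases h : a ∈ S
  · rw [hs.kill_mem h]
    exact (wlen_mul_le _ _).trans (Nat.add_le_add_left hs.wlen_le _)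
  · rw [hs.kill_not_mem h, mul_one]
    exact Nat.le_succ _

theorem nd_kill_le (S : Set V) (x y : Raag Γ) : nd (kill S x) (kill S y) ≤ nd x y := by
  have := wlen_kill_le S (x⁻¹ * y)
  rwa [map_mul, map_inv] at this

theorem expoZ_eq_zero {T : Set V} {b : V} (hb : b ∉ T) {x : Raag Γ} (hx : x ∈ subRaag Γ T) :
    expoZ b x = 0 := by
  refine subRaag_induction (p := fun x => expoZ b x = 0) (expoZ_one b) ?_ x hx
  intro x hx a ha s hs ih
  have hab : a ≠ b := fun h => hb (h ▸ ha)
  rw [expoZ_mul, ih, hs.expoZ_ne hab, add_zero]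

open Classical in
/-- The retraction onto the free group on two nonadjacent vertices. -/
def toFree {a c : V} (hac : ¬ Γ.Adj a c) : Raag Γ →* FreeGroup Bool :=
  raagLift (fun x => if x = a then FreeGroup.of true else if x = c then FreeGroup.of false else 1)
    (by
      intro x y hxy
      have hca : ¬ Γ.Adj c a := fun h => hac h.symm
      by_cases h1 : x = a <;> by_cases h2 : y = a <;> by_cases h3 : x = c <;>
        by_cases h4 : y = c <;> simp_all)

variable {a c : V} (hac : ¬ Γ.Adj a c) (hne : a ≠ c)

theorem toFree_left : toFree hac (raagGen Γ a) = FreeGroup.of true := by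
  simp [toFree, raagLift_gen]

include hne in
theorem toFree_right : toFree hac (raagGen Γ c) = FreeGroup.of false := by
  simp [toFree, raagLift_gen, hne.symm]

theorem norm_toFree_le (x : Raag Γ) : (toFree hac x).norm ≤ wlen x := by
  have hgen : ∀ b, (toFree hac (raagGen Γ b)).norm ≤ 1 := by
    intro b
    simp only [toFree, raagLift_gen]
    split_ifs <;> simp
  refine le_wlen (N := fun x => (toFree hac x).norm) (by simp) (fun x b s hs => ?_) x
  simp only [map_mul]
  refine (FreeGroup.norm_mul_le _ _).trans (Nat.add_le_add_left ?_ _)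
  rcases hs with rfl | rfl
  · exact hgen b
  · rw [map_inv, FreeGroup.norm_inv_eq]
    exact hgen b

/-- The element of the group spelled by a positive word in two generators. -/
def posWord (Γ : SimpleGraph V) (a c : V) (l : List Bool) : Raag Γ :=
  (l.map fun i => if i then raagGen Γ a else raagGen Γ c).prod

theorem posWord_nil : posWord Γ a c [] = 1 := rfl

theorem posWord_concat (l : List Bool) (i : Bool) :
    posWord Γ a c (l ++ [i]) = posWord Γ a c l * (if i then raagGen Γ a else raagGen Γ c) := by
  simp [posWord]

theorem letter_ite (i : Bool) :
    Letter Γ (if i then a else c) (if i then raagGen Γ a else raagGen Γ c) := by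
  cases i
  · exact Letter.gen c
  · exact Letter.gen a

theorem posWord_mem {T : Set V} (ha : a ∈ T) (hc : c ∈ T) (l : List Bool) :
    posWord Γ a c l ∈ subRaag Γ T := by
  induction l using List.reverseRecOn with
  | nil => exact one_mem _
  | append_singleton l i ih =>
    rw [posWord_concat]
    refine mul_mem ih ((letter_ite i).mem_subRaag ?_)
    cases i <;> simpa

theorem wlen_posWord_le (l : List Bool) : wlen (posWord Γ a c l) ≤ l.length := by
  induction l using List.reverseRecOn with
  | nil => simp [posWord_nil, wlen_one]
  | append_singleton l i ih =>
    rw [posWord_concat, List.length_append]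
    exact (wlen_mul_le _ _).trans (Nat.add_le_add ih (letter_ite i).wlen_le)

include hne in
theorem toFree_posWord (l : List Bool) :
    toFree hac (posWord Γ a c l) = FreeGroup.mk (l.map fun i => (i, true)) := by
  induction l with
  | nil => rw [posWord_nil, map_one]; rfl
  | cons i l ih =>
    have h : posWord Γ a c (i :: l) = (if i then raagGen Γ a else raagGen Γ c) *
        posWord Γ a c l := by simp [posWord]
    rw [h, map_mul, ih, List.map_cons]
    cases i
    · simp only [Bool.false_eq_true, if_false, toFree_right hac hne]; rfl
    · simp only [if_true, toFree_left]; rfl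

theorem toWord_positive (l : List Bool) :
    (FreeGroup.mk (l.map fun i => (i, true))).toWord = l.map fun i => (i, true) := by
  rw [FreeGroup.toWord_mk]
  apply FreeGroup.IsReduced.reduce_eq
  rw [FreeGroup.IsReduced, List.isChain_map]
  exact (List.pairwise_of_forall fun _ _ _ => rfl).isChain

include hne in
theorem toFree_posWord_injective :
    Function.Injective fun l => toFree hac (posWord Γ a c l) := by
  intro l m h
  have h1 := congrArg FreeGroup.toWord h
  simp only [toFree_posWord hac hne, toWord_positive] at h1
  exact List.map_injective_iff.mpr (fun i j h => (Prod.ext_iff.mp h).1) h1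

include hac hne in
theorem posWord_injective : Function.Injective (posWord Γ a c) :=
  fun _ _ h => toFree_posWord_injective hac hne (congrArg (toFree hac) h)

theorem freeGroup_of_zpow (i : Bool) (n : ℤ) :
    (FreeGroup.of i) ^ n = FreeGroup.mk (List.replicate n.natAbs (i, decide (0 ≤ n))) := by
  have hpow : ∀ (k : ℕ), (FreeGroup.of i) ^ k = FreeGroup.mk (List.replicate k (i, true)) := by
    intro k
    rw [← FreeGroup.toWord_of_pow, FreeGroup.mk_toWord]
  cases n with
  | ofNat k => simpa using hpow k
  | negSucc k =>
    rw [zpow_negSucc, hpow, FreeGroup.inv_mk]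
    simp [FreeGroup.invRev]

include hac hne in
theorem le_wlen_zpow_mul_zpow {s : Raag Γ} (hs : Letter Γ c s) (n m : ℤ) :
    n.natAbs + m.natAbs ≤ wlen (raagGen Γ a ^ n * s * raagGen Γ a ^ m) := by
  have hts : ∃ e : Bool, toFree hac s = FreeGroup.mk [(false, e)] := by
    rcases hs with rfl | rfl
    · exact ⟨true, toFree_right hac hne⟩
    · exact ⟨false, by rw [map_inv, toFree_right hac hne]; rfl⟩
  obtain ⟨e, he⟩ := hts
  refine le_trans ?_ (norm_toFree_le hac _)
  rw [map_mul, map_mul, map_zpow, map_zpow, toFree_left, he, freeGroup_of_zpow,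
    freeGroup_of_zpow, FreeGroup.mul_mk, FreeGroup.mul_mk, FreeGroup.norm, FreeGroup.toWord_mk,
    FreeGroup.IsReduced.reduce_eq]
  · simp
  · simp only [FreeGroup.IsReduced, List.append_assoc]
    rw [List.isChain_append, List.singleton_append, List.isChain_cons]
    refine ⟨List.isChain_replicate_of_rel _ (fun _ => rfl), ⟨?_,
      List.isChain_replicate_of_rel _ (fun _ => rfl)⟩, ?_⟩
    · intro y hy
      have := List.eq_of_mem_replicate (List.mem_of_mem_head? hy)
      subst this
      simp
    · intro x hx y hy
      have := List.eq_of_mem_replicate (List.mem_of_mem_getLast? hx)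
      subst this
      simp at hy
      subst hy
      simp

end Homs

/-! ### The two sides of a standard geodesic -/

section Sides

variable {V : Type} {Γ : SimpleGraph V} {v : V} {I : Set V}

/-- `I` is a union of connected components of `Γ` with `v` removed. -/
def ClosedOff (Γ : SimpleGraph V) (v : V) (I : Set V) : Prop :=
  v ∉ I ∧ ∀ x ∈ I, ∀ y, Γ.Adj x y → y ≠ v → y ∈ I

/-- The cyclic subgroup generated by a vertex. -/
def lineOf (Γ : SimpleGraph V) (v : V) : Subgroup (Raag Γ) := Subgroup.zpowers (raagGen Γ v)

theorem mem_lineOf {x : Raag Γ} : x ∈ lineOf Γ v ↔ ∃ k : ℤ, raagGen Γ v ^ k = x :=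
  Subgroup.mem_zpowers_iff

theorem Letter.mem_lineOf {s : Raag Γ} (h : Letter Γ v s) : s ∈ lineOf Γ v := by
  rcases h with rfl | rfl
  · exact Subgroup.mem_zpowers _
  · exact inv_mem (Subgroup.mem_zpowers _)

theorem lineOf_le_subRaag {S : Set V} (h : v ∈ S) : lineOf Γ v ≤ subRaag Γ S := by
  rw [lineOf, Subgroup.zpowers_le]
  exact raagGen_mem_subRaag h

theorem Letter.not_mem_lineOf {a : V} {s : Raag Γ} (h : Letter Γ a s) (hav : a ≠ v) :
    s ∉ lineOf Γ v := by
  intro hs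
  have h1 := h.expoZ_self
  have h2 := expoZ_eq_zero (T := {v}) (b := a) (by simpa using hav)
    (lineOf_le_subRaag (S := {v}) rfl hs)
  omega

open Classical in
/-- The indicator function of the line through the identity. -/
def ind (v : V) (x : Raag Γ) : ℤ := if x ∈ lineOf Γ v then 1 else 0

theorem ind_mem {x : Raag Γ} (h : x ∈ lineOf Γ v) : ind v x = 1 := if_pos h

theorem ind_not_mem {x : Raag Γ} (h : x ∉ lineOf Γ v) : ind v x = 0 := if_neg h

theorem ind_mul_left {g : Raag Γ} (h : g ∈ lineOf Γ v) (x : Raag Γ) :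
    ind v (g * x) = ind v x := by
  have h1 : g * x ∈ lineOf Γ v ↔ x ∈ lineOf Γ v := Subgroup.mul_mem_cancel_left _ h
  by_cases h2 : x ∈ lineOf Γ v
  · rw [ind_mem h2, ind_mem (h1.mpr h2)]
  · rw [ind_not_mem h2, ind_not_mem (fun h3 => h2 (h1.mp h3))]

theorem ind_mul_right {g : Raag Γ} (h : g ∈ lineOf Γ v) (x : Raag Γ) :
    ind v (x * g) = ind v x := by
  have h1 : x * g ∈ lineOf Γ v ↔ x ∈ lineOf Γ v := Subgroup.mul_mem_cancel_right _ h
  by_cases h2 : x ∈ lineOf Γ v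
  · rw [ind_mem h2, ind_mem (h1.mpr h2)]
  · rw [ind_not_mem h2, ind_not_mem (fun h3 => h2 (h1.mp h3))]

theorem ind_inv (x : Raag Γ) : ind v x⁻¹ = ind v x := by
  by_cases h : x ∈ lineOf Γ v
  · rw [ind_mem h, ind_mem (inv_mem h)]
  · rw [ind_not_mem h, ind_not_mem (fun h' => h (inv_mem_iff.mp h'))]

/-- Left translation on the product of the group with the integers. -/
def transPerm (Γ : SimpleGraph V) : Raag Γ →* Equiv.Perm (Raag Γ × ℤ) where
  toFun g := (Equiv.mulLeft g).prodCongr (Equiv.refl ℤ)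
  map_one' := by ext x <;> simp
  map_mul' g h := by ext x <;> simp [mul_assoc]

/-- The shear by the indicator function of a line. -/
def shearPerm (Γ : SimpleGraph V) (v : V) : Equiv.Perm (Raag Γ × ℤ) where
  toFun x := (x.1, x.2 - ind v x.1)
  invFun x := (x.1, x.2 + ind v x.1)
  left_inv x := by simp
  right_inv x := by simp

open Classical in
/-- The permutation by which a vertex acts on coloured group elements. -/
def colorPerm (Γ : SimpleGraph V) (v : V) (I : Set V) (a : V) : Equiv.Perm (Raag Γ × ℤ) :=
  if a ∈ I then shearPerm Γ v * transPerm Γ (raagGen Γ a) * (shearPerm Γ v)⁻¹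
  else transPerm Γ (raagGen Γ a)

theorem colorPerm_commute (h : ClosedOff Γ v I) {a b : V} (hab : Γ.Adj a b) :
    Commute (colorPerm Γ v I a) (colorPerm Γ v I b) := by
  have h0 : ∀ {a b : V}, Γ.Adj a b →
      Commute (transPerm Γ (raagGen Γ a)) (transPerm Γ (raagGen Γ b)) := fun hab =>
    Commute.map (raagGen_comm hab) (transPerm Γ)
  have h1 : Commute (shearPerm Γ v) (transPerm Γ (raagGen Γ v)) := by
    refine Equiv.ext fun x => Prod.ext rfl ?_
    simp [shearPerm, transPerm, ind_mul_left (Letter.gen v).mem_lineOf]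
  have h2 : ∀ {a b : V}, Γ.Adj a b → a ∈ I → b ∉ I →
      Commute (colorPerm Γ v I a) (colorPerm Γ v I b) := by
    intro a b hab ha hb
    have hbv : b = v := by
      by_contra hne
      exact hb (h.2 a ha b hab hne)
    subst hbv
    rw [colorPerm, colorPerm, if_pos ha, if_neg hb]
    exact (h1.mul_left (h0 hab)).mul_left h1.inv_left
  by_cases ha : a ∈ I <;> by_cases hb : b ∈ I
  · rw [colorPerm, colorPerm, if_pos ha, if_pos hb]
    exact (Commute.conj_iff _).mpr (h0 hab)
  · exact h2 hab ha hb
  · exact (h2 hab.symm hb ha).symm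
  · rw [colorPerm, colorPerm, if_neg ha, if_neg hb]
    exact h0 hab

/-- The colour of a group element: `1` on the side of the line spanned by `v` indicated by `I`,
and `0` elsewhere. -/
def ClosedOff.col (h : ClosedOff Γ v I) (x : Raag Γ) : ℤ :=
  (raagLift (colorPerm Γ v I) (fun _ _ => colorPerm_commute h) x⁻¹ (1, 0)).2

variable (h : ClosedOff Γ v I)

theorem ClosedOff.col_one : h.col 1 = 0 := by simp [ClosedOff.col]

theorem ClosedOff.colorPerm_fst (x : Raag Γ) (p : Raag Γ × ℤ) :
    (raagLift (colorPerm Γ v I) (fun _ _ => colorPerm_commute h) x p).1 = x * p.1 := by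
  have hg : ∀ (a : V) (p : Raag Γ × ℤ), (colorPerm Γ v I a p).1 = raagGen Γ a * p.1 := by
    intro a p
    rw [colorPerm]
    split_ifs
    · rfl
    · rfl
  induction x using raag_induction generalizing p with
  | h1 => simp
  | hs x a s hs ih =>
    rw [map_mul, Equiv.Perm.mul_apply, ih, mul_assoc]
    congr 1
    rcases hs with rfl | rfl
    · rw [raagLift_gen, hg]
    · rw [map_inv, raagLift_gen, eq_inv_mul_iff_mul_eq, ← hg, ← Equiv.Perm.mul_apply,
        mul_inv_cancel, Equiv.Perm.one_apply]

open Classical in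
theorem ClosedOff.col_mul_letter (z : Raag Γ) {a : V} {s : Raag Γ} (hs : Letter Γ a s) :
    h.col (z * s) = h.col z + if a ∈ I then ind v z - ind v (z * s) else 0 := by
  set Θ := raagLift (colorPerm Γ v I) (fun _ _ => colorPerm_commute h) with hΘ
  have key : ∀ w : Raag Γ, (Θ (raagGen Γ a * w) (1, 0)).2 =
      (Θ w (1, 0)).2 + if a ∈ I then ind v w - ind v (raagGen Γ a * w) else 0 := by
    intro w
    have h1 : Θ w (1, 0) = (w, (Θ w (1, 0)).2) :=
      Prod.ext ((h.colorPerm_fst w (1, 0)).trans (mul_one w)) rfl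
    rw [map_mul, Equiv.Perm.mul_apply, h1, hΘ, raagLift_gen, colorPerm]
    split_ifs with ha
    · simp [shearPerm, transPerm, Equiv.Perm.inv_def, Equiv.symm]
      ring
    · simp [transPerm]
  rcases hs with rfl | rfl
  · have := key (raagGen Γ a)⁻¹ |>.symm
    have h2 := key (z * raagGen Γ a)⁻¹
    rw [mul_inv_rev, mul_inv_cancel_left] at h2
    rw [ClosedOff.col, ClosedOff.col, ← hΘ, mul_inv_rev, h2, ← mul_inv_rev, ind_inv, ind_inv]
    split_ifs <;> ring
  · rw [ClosedOff.col, ClosedOff.col, ← hΘ, mul_inv_rev, inv_inv, key z⁻¹, ind_inv,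
      ← ind_inv (raagGen Γ a * z⁻¹), mul_inv_rev, inv_inv]

theorem ClosedOff.col_mul_of_not_mem (z : Raag Γ) {a : V} {s : Raag Γ} (hs : Letter Γ a s)
    (ha : a ∉ I) : h.col (z * s) = h.col z := by
  rw [h.col_mul_letter z hs, if_neg ha, add_zero]

theorem ClosedOff.col_edge {z : Raag Γ} {a : V} {s : Raag Γ} (hs : Letter Γ a s)
    (hz : z ∉ lineOf Γ v) (hzs : z * s ∉ lineOf Γ v) : h.col (z * s) = h.col z := by
  rw [h.col_mul_letter z hs, ind_not_mem hz, ind_not_mem hzs]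
  simp

theorem ClosedOff.col_compl {x : Raag Γ} (hx : x ∈ subRaag Γ Iᶜ) : h.col x = 0 := by
  refine subRaag_induction (p := fun x => h.col x = 0) h.col_one ?_ x hx
  intro x _ a ha s hs ih
  rw [h.col_mul_of_not_mem x hs ha, ih]

theorem ClosedOff.col_line {x : Raag Γ} (hx : x ∈ lineOf Γ v) : h.col x = 0 :=
  h.col_compl (lineOf_le_subRaag (S := Iᶜ) h.1 hx)

theorem ClosedOff.not_mem_of_col {x : Raag Γ} (hx : h.col x = 1) : x ∉ lineOf Γ v := by
  intro h'
  rw [h.col_line h'] at hx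
  exact zero_ne_one hx

theorem ClosedOff.col_eq (x : Raag Γ) : h.col x = 0 ∨ h.col x = 1 := by
  induction x using raag_induction with
  | h1 => exact Or.inl h.col_one
  | hs z a s hs ih =>
    by_cases hzs : z * s ∈ lineOf Γ v
    · exact Or.inl (h.col_line hzs)
    by_cases hz : z ∈ lineOf Γ v
    · rw [h.col_mul_letter z hs, ind_mem hz, ind_not_mem hzs, h.col_line hz]
      split_ifs <;> simp
    · rw [h.col_edge hs hz hzs]
      exact ih

theorem ClosedOff.col_mul_left {g : Raag Γ} (hg : g ∈ lineOf Γ v) (x : Raag Γ) :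
    h.col (g * x) = h.col x := by
  induction x using raag_induction with
  | h1 => rw [mul_one, h.col_line hg, h.col_one]
  | hs z a s hs ih =>
    rw [← mul_assoc, h.col_mul_letter (g * z) hs, h.col_mul_letter z hs, ih, mul_assoc,
      ind_mul_left hg, ind_mul_left hg]

/-- The vertices that lie neither on `v` nor in `I`. -/
def otherSide (v : V) (I : Set V) : Set V := {u | u ≠ v ∧ u ∉ I}

include h in
theorem ClosedOff.other : ClosedOff Γ v (otherSide v I) := by
  refine ⟨fun hv => hv.1 rfl, fun x hx y hxy hy => ⟨hy, fun hyI => ?_⟩⟩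
  exact hx.2 (h.2 y hyI x hxy.symm hx.1)

theorem ClosedOff.col_add_col (x : Raag Γ) : h.col x + h.other.col x + ind v x = 1 := by
  induction x using raag_induction with
  | h1 => rw [h.col_one, h.other.col_one, ind_mem (one_mem _)]; rfl
  | hs z a s hs ih =>
    rw [h.col_mul_letter z hs, h.other.col_mul_letter z hs]
    by_cases haI : a ∈ I
    · rw [if_pos haI, if_neg (fun h' => h'.2 haI)]
      omega
    · by_cases hav : a = v
      · subst hav
        rw [if_neg haI, if_neg (fun h' => h'.1 rfl), ind_mul_right hs.mem_lineOf]
        omega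
      · rw [if_neg haI, if_pos ⟨hav, haI⟩]
        omega

theorem ClosedOff.col_other {x : Raag Γ} (hx : x ∉ lineOf Γ v) :
    h.other.col x = 1 ↔ h.col x = 0 := by
  have := h.col_add_col x
  rw [ind_not_mem hx] at this
  omega

theorem ClosedOff.col_insert {x : Raag Γ} (hx : x ∈ subRaag Γ (insert v I))
    (hx' : x ∉ lineOf Γ v) : h.col x = 1 := by
  have h1 : h.other.col x = 0 := by
    refine h.other.col_compl (subRaag_mono ?_ hx)
    rintro u (rfl | hu) h'
    · exact h'.1 rfl
    · exact h'.2 hu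
  have := h.col_add_col x
  rw [ind_not_mem hx'] at this
  omega

theorem ClosedOff.other_col_compl {x : Raag Γ} (hx : x ∈ subRaag Γ Iᶜ)
    (hx' : x ∉ lineOf Γ v) : h.other.col x = 1 :=
  (h.col_other hx').mpr (h.col_compl hx)

theorem ClosedOff.col_letter {a : V} {s : Raag Γ} (hs : Letter Γ a s) (ha : a ∈ I) :
    h.col s = 1 := by
  have hav : a ≠ v := fun e => h.1 (e ▸ ha)
  exact h.col_insert (hs.mem_subRaag (Or.inr ha)) (hs.not_mem_lineOf hav)

theorem ClosedOff.nested {g : Raag Γ} (hg : g ∈ subRaag Γ Iᶜ) (hg' : g ∉ lineOf Γ v)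
    {z : Raag Γ} (hz : h.col z = 1) : h.other.col (g * z) = 1 := by
  suffices H : h.col z = 0 ∨ h.other.col (g * z) = 1 by omega
  clear hz
  induction z using raag_induction with
  | h1 => exact Or.inl h.col_one
  | hs z a s hs ih =>
    by_cases hzs : g * (z * s) ∈ lineOf Γ v
    · refine Or.inl (h.col_compl ?_)
      have := mul_mem (inv_mem hg) (lineOf_le_subRaag (S := Iᶜ) h.1 hzs)
      rwa [inv_mul_cancel_left] at this
    rw [h.col_mul_letter z hs]
    rcases ih with ih | ih
    · by_cases hz : z ∈ lineOf Γ v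
      · by_cases haI : a ∈ I
        · right
          rw [← mul_assoc, h.other.col_mul_of_not_mem _ hs (fun h' => h'.2 haI)]
          refine h.other_col_compl (mul_mem hg (lineOf_le_subRaag (S := Iᶜ) h.1 hz)) ?_
          rwa [Subgroup.mul_mem_cancel_right _ hz]
        · left
          rw [if_neg haI, ih, add_zero]
      · left
        rw [← h.col_mul_letter z hs]
        by_cases hzs' : z * s ∈ lineOf Γ v
        · exact h.col_line hzs'
        · rw [h.col_edge hs hz hzs', ih]
    · right
      rw [← mul_assoc] at hzs ⊢
      rw [h.other.col_edge hs (h.other.not_mem_of_col ih) hzs, ih]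

theorem ClosedOff.exists_branch {y : Raag Γ} (hy : y ∉ subRaag Γ Iᶜ) :
    ∃ g ∈ subRaag Γ Iᶜ, h.col (g⁻¹ * y) = 1 := by
  suffices H : y ∈ subRaag Γ Iᶜ ∨ ∃ g ∈ subRaag Γ Iᶜ, h.col (g⁻¹ * y) = 1 from
    H.resolve_left hy
  clear hy
  induction y using raag_induction with
  | h1 => exact Or.inl (one_mem _)
  | hs y a s hs ih =>
    rcases ih with ih | ⟨g, hg, ih⟩
    · by_cases haI : a ∈ I
      · exact Or.inr ⟨y, ih, by rw [inv_mul_cancel_left]; exact h.col_letter hs haI⟩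
      · exact Or.inl (mul_mem ih (hs.mem_subRaag haI))
    · by_cases hgs : g⁻¹ * y * s ∈ lineOf Γ v
      · left
        have := mul_mem hg (lineOf_le_subRaag (S := Iᶜ) h.1 hgs)
        rwa [mul_assoc, mul_inv_cancel_left] at this
      · refine Or.inr ⟨g, hg, ?_⟩
        rw [← mul_assoc, h.col_edge hs (h.not_mem_of_col ih) hgs, ih]

end Sides

/-! ### Subsets of linear growth do not separate -/

section Counting

variable {W : Type} {Λ : SimpleGraph W}

/-- The point `x` is at distance more than `D` from `Y`. -/
def Deep (Y : Set (Raag Λ)) (D : ℕ) (x : Raag Λ) : Prop := ∀ y ∈ Y, D < nd x y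

theorem Deep.mono {Y : Set (Raag Λ)} {D E : ℕ} {x : Raag Λ} (h : Deep Y D x) (hED : E ≤ D) :
    Deep Y E x := fun y hy => hED.trans_lt (h y hy)

theorem Deep.not_mem {Y : Set (Raag Λ)} {D : ℕ} {x : Raag Λ} (h : Deep Y D x) : x ∉ Y := by
  intro hx
  have := h x hx
  rw [nd_self] at this
  omega

theorem Deep.not_mem_of_le {Y : Set (Raag Λ)} {D : ℕ} {x z : Raag Λ} (h : Deep Y D x)
    (hz : nd x z ≤ D) : z ∉ Y := fun hz' => absurd (h z hz') (not_lt.mpr hz)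

theorem Deep.mul_letter {Y : Set (Raag Λ)} {D : ℕ} {x : Raag Λ} (h : Deep Y (D + 1) x)
    {a : W} {s : Raag Λ} (hs : Letter Λ a s) : Deep Y D (x * s) := by
  intro y hy
  have h1 := h y hy
  have h2 := nd_triangle x (x * s) y
  have h3 := nd_letter hs x
  omega

/-- Balls meet `Y` in a number of points that is linear in the radius. -/
def LinGrowth (Y : Set (Raag Λ)) (C : ℕ) : Prop :=
  ∀ (x : Raag Λ) (r : ℕ) (Z : Finset (Raag Λ)), (∀ z ∈ Z, z ∈ Y ∧ nd x z ≤ r) →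
    Z.card ≤ C * (r + 1)

open Classical in
/-- The binary words of a given length all of whose nonempty prefixes satisfy `P`. -/
def goodWords (P : List Bool → Prop) : ℕ → Finset (List Bool)
  | 0 => {[]}
  | r + 1 => ((goodWords P r ×ˢ Finset.univ).image fun p => p.1 ++ [p.2]).filter P

theorem length_of_mem_goodWords {P : List Bool → Prop} {r : ℕ} {l : List Bool}
    (h : l ∈ goodWords P r) : l.length = r := by
  classical
  induction r generalizing l with
  | zero => simp [goodWords] at h; simp [h]
  | succ r ih =>
    simp only [goodWords, Finset.mem_filter, Finset.mem_image, Finset.mem_product] at h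
    obtain ⟨⟨⟨w, i⟩, ⟨hw, _⟩, rfl⟩, _⟩ := h
    simp [ih hw]

theorem card_goodWords_succ {P : List Bool → Prop} {r B : ℕ}
    (hB : ∀ Z : Finset (List Bool), (∀ l ∈ Z, l.length = r + 1 ∧ ¬ P l) → Z.card ≤ B) :
    2 * (goodWords P r).card ≤ (goodWords P (r + 1)).card + B := by
  classical
  set U := (goodWords P r ×ˢ (Finset.univ : Finset Bool)).image fun p => p.1 ++ [p.2] with hU
  have hcard : U.card = 2 * (goodWords P r).card := by
    rw [hU, Finset.card_image_of_injective, Finset.card_product]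
    · simp [mul_comm]
    · rintro ⟨w, i⟩ ⟨w', j⟩ h
      obtain ⟨rfl, h2⟩ := List.append_inj' h rfl
      simpa using h2
  have h1 : (goodWords P (r + 1)).card = (U.filter P).card := by
    rw [goodWords]
  have h2 := hB (U.filter fun l => ¬ P l) (by
    intro l hl
    rw [Finset.mem_filter, hU, Finset.mem_image] at hl
    obtain ⟨⟨⟨w, i⟩, hw, rfl⟩, hP⟩ := hl
    rw [Finset.mem_product] at hw
    exact ⟨by simp [length_of_mem_goodWords hw.1], hP⟩)
  have h3 := Finset.card_filter_add_card_filter_not (s := U) P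
  omega

theorem goodWords_induction {P Q : List Bool → Prop} (h0 : Q [])
    (hs : ∀ w i, P (w ++ [i]) → (w = [] ∨ P w) → Q w → Q (w ++ [i])) {r : ℕ} {l : List Bool}
    (hl : l ∈ goodWords P r) : Q l := by
  classical
  suffices H : (l = [] ∨ P l) ∧ Q l from H.2
  induction r generalizing l with
  | zero => simp [goodWords] at hl; subst hl; exact ⟨Or.inl rfl, h0⟩
  | succ r ih =>
    simp only [goodWords, Finset.mem_filter, Finset.mem_image, Finset.mem_product] at hl
    obtain ⟨⟨⟨w, i⟩, ⟨hw, _⟩, rfl⟩, hP⟩ := hl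
    obtain ⟨h1, h2⟩ := ih hw
    exact ⟨Or.inr hP, hs w i hP h1 h2⟩

theorem card_goodWords {P : List Bool → Prop} {C D : ℕ} (hD : 2 * C * (D + 3) + 1 ≤ 2 ^ D)
    (hsmall : ∀ l : List Bool, l.length ≤ D → P l)
    (hB : ∀ r, ∀ Z : Finset (List Bool), (∀ l ∈ Z, l.length = r + 1 ∧ ¬ P l) →
      Z.card ≤ 2 * C * (r + 2)) (j : ℕ) :
    2 * C * (D + j + 3) + 2 ^ j ≤ (goodWords P (D + j)).card := by
  induction j with
  | zero =>
    have key : ∀ r ≤ D, 2 ^ r ≤ (goodWords P r).card := by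
      intro r hr
      induction r with
      | zero => simp [goodWords]
      | succ r ih =>
        have h1 := card_goodWords_succ (P := P) (r := r) (B := 0) (by
          intro Z hZ
          rw [Nat.le_zero, Finset.card_eq_zero, Finset.eq_empty_iff_forall_notMem]
          intro l hl
          exact (hZ l hl).2 (hsmall l (by rw [(hZ l hl).1]; exact hr)))
        have h2 := ih (by omega)
        rw [pow_succ]
        omega
    have := key D le_rfl
    simp only [Nat.add_zero, pow_zero]
    omega
  | succ j ih =>
    have h1 := card_goodWords_succ (P := P) (hB (D + j))
    rw [← add_assoc]
    rw [pow_succ]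
    nlinarith

theorem exists_depth (C : ℕ) : ∃ D : ℕ, 2 * C * (D + 3) + 1 ≤ 2 ^ D := by
  refine ⟨2 * (6 * C), ?_⟩
  have h := Nat.lt_two_pow_self (n := 6 * C)
  rw [pow_mul']
  nlinarith

variable {Y : Set (Raag Λ)} {C D : ℕ} {T : Set W} {α : Type*} {γ : Raag Λ → α}

theorem eq_of_deep_of_nat (hY : LinGrowth Y C) (hD : 2 * C * (D + 3) + 1 ≤ 2 ^ D)
    (hγ : ∀ z ∈ subRaag Λ T, ∀ a ∈ T, ∀ s, Letter Λ a s → z ∉ Y → z * s ∉ Y → γ (z * s) = γ z)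
    {a b c : W} (ha : a ∈ T) (hb : b ∈ T) (hc : c ∈ T) (hac : a ≠ c) (hac' : ¬ Λ.Adj a c)
    (hba : Λ.Adj b a) (hbc : Λ.Adj b c) {x : Raag Λ} (hx : x ∈ subRaag Λ T) (n : ℕ)
    (h0 : Deep Y D x) (hn : Deep Y D (x * raagGen Λ b ^ n)) :
    γ (x * raagGen Λ b ^ n) = γ x := by
  classical
  set p := posWord Λ a c with hp
  have hinj : Function.Injective p := posWord_injective hac' hac
  have hpT : ∀ l, p l ∈ subRaag Λ T := posWord_mem ha hc
  have hcomm : ∀ l, Commute (raagGen Λ b) (p l) := by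
    intro l
    induction l using List.reverseRecOn with
    | nil => rw [hp, posWord_nil]; exact Commute.one_right _
    | append_singleton l i ih =>
      rw [hp, posWord_concat]
      refine ih.mul_right ((Letter.gen b).commute (letter_ite i) (Or.inl ?_))
      cases i <;> simpa
  have hfree : toFree hac' (raagGen Λ b) = 1 := by
    simp [toFree, raagLift_gen, hba.ne, hbc.ne]
  set P : List Bool → Prop := fun l => x * p l ∉ Y ∧ x * raagGen Λ b ^ n * p l ∉ Y with hP
  have hcount : ∀ (y : Raag Λ) (r : ℕ) (Z : Finset (List Bool)),
      (∀ l ∈ Z, l.length = r + 1 ∧ y * p l ∈ Y) → Z.card ≤ C * (r + 2) := by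
    intro y r Z hZ
    have h1 := hY y (r + 1) (Z.image fun l => y * p l) (by
      intro z hz
      obtain ⟨l, hl, rfl⟩ := Finset.mem_image.mp hz
      refine ⟨(hZ l hl).2, ?_⟩
      rw [nd_mul_right, ← (hZ l hl).1]
      exact wlen_posWord_le l)
    rwa [Finset.card_image_of_injective _ fun l m h => hinj (mul_left_cancel h)] at h1
  have hlen : ∀ l : List Bool, ∀ y : Raag Λ, nd y (y * p l) ≤ l.length := fun l y => by
    rw [nd_mul_right]; exact wlen_posWord_le l
  have hcard := card_goodWords (P := P) hD
    (fun l hl => ⟨h0.not_mem_of_le ((hlen l _).trans hl), hn.not_mem_of_le ((hlen l _).trans hl)⟩)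
    (by
      intro r Z hZ
      have h1 := hcount x r (Z.filter fun l => x * p l ∈ Y) (fun l hl => by
        rw [Finset.mem_filter] at hl
        exact ⟨(hZ l hl.1).1, hl.2⟩)
      have h2 := hcount (x * raagGen Λ b ^ n) r (Z.filter fun l => ¬ x * p l ∈ Y) (fun l hl => by
        rw [Finset.mem_filter] at hl
        refine ⟨(hZ l hl.1).1, ?_⟩
        by_contra h3
        exact (hZ l hl.1).2 ⟨hl.2, h3⟩)
      have h3 := Finset.card_filter_add_card_filter_not (s := Z) fun l => x * p l ∈ Y
      rw [← h3]
      nlinarith) (C * n)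
  obtain ⟨w, hw, hwY⟩ : ∃ w ∈ goodWords P (D + C * n), ∀ k ≤ n,
      x * p w * raagGen Λ b ^ k ∉ Y := by
    by_contra! hcon
    choose! k hk hkY using hcon
    have h1 := hY x (D + C * n + n)
      ((goodWords P (D + C * n)).image fun w => x * p w * raagGen Λ b ^ k w) (by
        intro z hz
        obtain ⟨w, hw, rfl⟩ := Finset.mem_image.mp hz
        refine ⟨hkY w hw, ?_⟩
        have h2 := hlen w x
        have h3 := nd_triangle x (x * p w) (x * p w * raagGen Λ b ^ k w)
        have h4 : nd (x * p w) (x * p w * raagGen Λ b ^ k w) ≤ k w := by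
          rw [nd_mul_right]
          simpa using (Letter.gen b).wlen_zpow_le (k w : ℤ)
        have h5 := hk w hw
        rw [length_of_mem_goodWords hw] at h2
        omega)
    rw [Finset.card_image_of_injOn] at h1
    · have h2 := Nat.lt_two_pow_self (n := C * n)
      nlinarith
    · intro w _ w' _ h
      have h2 : p w * raagGen Λ b ^ k w = p w' * raagGen Λ b ^ k w' := by
        simpa [mul_assoc] using h
      have h3 := congrArg (fun y => (toFree hac' y)) h2
      simp only [map_mul, map_pow, hfree, one_pow, mul_one] at h3
      exact toFree_posWord_injective hac' hac h3
  have hbT : ∀ k : ℕ, raagGen Λ b ^ k ∈ subRaag Λ T := fun k =>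
    pow_mem (raagGen_mem_subRaag hb) k
  have hpath : ∀ y ∈ subRaag Λ T, y ∉ Y → (∀ l, P l → y * p l ∉ Y) → γ (y * p w) = γ y := by
    intro y hyT hy hyP
    refine goodWords_induction (P := P) (Q := fun w => γ (y * p w) = γ y) ?_ ?_ hw
    · simp only [hp, posWord_nil, mul_one]
    · intro w i h1 h2 h3
      rw [← h3, hp, posWord_concat, ← mul_assoc]
      refine hγ _ (mul_mem hyT (hpT w)) _ ?_ _ (letter_ite i) ?_ ?_
      · cases i <;> simpa
      · rcases h2 with rfl | h2
        · rwa [hp, posWord_nil, mul_one]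
        · exact hyP w h2
      · have := hyP _ h1
        rwa [hp, posWord_concat, ← mul_assoc] at this
  have h1 := hpath x hx h0.not_mem fun l hl => hl.1
  have h2 := hpath _ (mul_mem hx (hbT n)) hn.not_mem fun l hl => hl.2
  have h3 : ∀ k ≤ n, γ (x * p w * raagGen Λ b ^ k) = γ (x * p w) := by
    intro k hk
    induction k with
    | zero => simp
    | succ k ih =>
      rw [← ih (by omega), pow_succ, ← mul_assoc]
      refine hγ _ (mul_mem (mul_mem hx (hpT w)) (hbT k)) b hb _ (Letter.gen b)
        (hwY k (by omega)) ?_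
      have := hwY (k + 1) hk
      rwa [pow_succ, ← mul_assoc] at this
  rw [← h2, ← h1, ← h3 n le_rfl, mul_assoc x, mul_assoc x, ((hcomm w).pow_left n).eq]

theorem eq_of_deep (hY : LinGrowth Y C) (hD : 2 * C * (D + 3) + 1 ≤ 2 ^ D)
    (hγ : ∀ z ∈ subRaag Λ T, ∀ a ∈ T, ∀ s, Letter Λ a s → z ∉ Y → z * s ∉ Y → γ (z * s) = γ z)
    {a b c : W} (ha : a ∈ T) (hb : b ∈ T) (hc : c ∈ T) (hac : a ≠ c) (hac' : ¬ Λ.Adj a c)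
    (hba : Λ.Adj b a) (hbc : Λ.Adj b c) {x : Raag Λ} (hx : x ∈ subRaag Λ T) (m n : ℤ)
    (hm : Deep Y D (x * raagGen Λ b ^ m)) (hn : Deep Y D (x * raagGen Λ b ^ n)) :
    γ (x * raagGen Λ b ^ m) = γ (x * raagGen Λ b ^ n) := by
  have key : ∀ m n : ℤ, m ≤ n → Deep Y D (x * raagGen Λ b ^ m) →
      Deep Y D (x * raagGen Λ b ^ n) →
      γ (x * raagGen Λ b ^ m) = γ (x * raagGen Λ b ^ n) := by
    intro m n hmn hm hn
    obtain ⟨k, rfl⟩ := Int.le.dest hmn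
    rw [zpow_add, ← mul_assoc, zpow_natCast] at hn ⊢
    exact (eq_of_deep_of_nat hY hD hγ ha hb hc hac hac' hba hbc
      (mul_mem hx (zpow_mem (raagGen_mem_subRaag hb) m)) k hm hn).symm
  rcases le_total m n with h | h
  · exact key m n h hm hn
  · exact (key n m h hn hm).symm

/-- If sufficiently many standard lines contain deep points then all deep points have the same
colour. -/
theorem eq_of_pivots (hY : LinGrowth Y C) (hD : 2 * C * (D + 3) + 1 ≤ 2 ^ D)
    (hγ : ∀ z ∈ subRaag Λ T, ∀ a ∈ T, ∀ s, Letter Λ a s → z ∉ Y → z * s ∉ Y → γ (z * s) = γ z)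
    {P : Set W} (hPT : P ⊆ T)
    (hP : ∀ b ∈ P, ∃ a ∈ T, ∃ c ∈ T, a ≠ c ∧ ¬ Λ.Adj a c ∧ Λ.Adj b a ∧ Λ.Adj b c)
    (hlines : ∀ x ∈ subRaag Λ T, ∀ b ∈ P, ∃ k : ℤ, Deep Y (D + 1) (x * raagGen Λ b ^ k))
    (hconn : ∀ b ∈ P, ∀ b' ∈ P,
      Relation.ReflTransGen (fun p q => Λ.Adj p q ∧ p ∈ P ∧ q ∈ P) b b')
    (hdom : ∀ s ∈ T, ∃ b ∈ P, s = b ∨ Λ.Adj s b) (hne : P.Nonempty)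
    {x y : Raag Λ} (hx : x ∈ subRaag Λ T) (hy : y ∈ subRaag Λ T)
    (hxD : Deep Y D x) (hyD : Deep Y D y) : γ x = γ y := by
  choose! k hk using hlines
  set κ : Raag Λ → W → α := fun x b => γ (x * raagGen Λ b ^ k x b) with hκ
  have hgT : ∀ b ∈ P, ∀ j : ℤ, raagGen Λ b ^ j ∈ subRaag Λ T := fun b hb j =>
    zpow_mem (raagGen_mem_subRaag (hPT hb)) j
  have hL1 : ∀ x ∈ subRaag Λ T, ∀ b ∈ P, ∀ j : ℤ, Deep Y D (x * raagGen Λ b ^ j) →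
      γ (x * raagGen Λ b ^ j) = κ x b := by
    intro x hx b hb j hj
    obtain ⟨a, ha, c, hc, hac, hac', hba, hbc⟩ := hP b hb
    exact eq_of_deep hY hD hγ ha (hPT hb) hc hac hac' hba hbc hx _ _ hj
      ((hk x hx b hb).mono (Nat.le_succ D))
  have hL0 : ∀ x ∈ subRaag Λ T, ∀ b ∈ P, Deep Y D x → γ x = κ x b := by
    intro x hx b hb hxD
    have := hL1 x hx b hb 0
    rw [zpow_zero, mul_one] at this
    exact this hxD
  have hL2 : ∀ x ∈ subRaag Λ T, ∀ b ∈ P, ∀ a ∈ T, ∀ s, Letter Λ a s → (Λ.Adj a b ∨ a = b) →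
      κ (x * s) b = κ x b := by
    intro x hx b hb a ha s hs hab
    have hcom : s * raagGen Λ b ^ k x b = raagGen Λ b ^ k x b * s :=
      ((hs.commute (Letter.gen b) hab).zpow_right _).eq
    have hdeep := (hk x hx b hb).mul_letter hs
    have h1 := hγ _ (mul_mem hx (hgT b hb (k x b))) a ha s hs (hk x hx b hb).not_mem
      hdeep.not_mem
    rw [mul_assoc, ← hcom, ← mul_assoc] at h1 hdeep
    rw [← hL1 (x * s) (mul_mem hx (hs.mem_subRaag ha)) b hb _ hdeep, h1]
  have hL2' : ∀ x ∈ subRaag Λ T, ∀ b ∈ P, ∀ a ∈ T, (Λ.Adj a b ∨ a = b) → ∀ j : ℤ,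
      κ (x * raagGen Λ a ^ j) b = κ x b := by
    intro x hx b hb a ha hab j
    have haT : ∀ j : ℤ, raagGen Λ a ^ j ∈ subRaag Λ T := fun j =>
      zpow_mem (raagGen_mem_subRaag ha) j
    induction j using Int.induction_on with
    | zero => rw [zpow_zero, mul_one]
    | succ j ih =>
      rw [zpow_add_one, ← mul_assoc,
        hL2 _ (mul_mem hx (haT _)) b hb a ha _ (Letter.gen a) hab, ih]
    | pred j ih =>
      rw [zpow_sub_one, ← mul_assoc,
        hL2 _ (mul_mem hx (haT _)) b hb a ha _ (Letter.gen_inv a) hab, ih]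
  have hL3 : ∀ x ∈ subRaag Λ T, ∀ b ∈ P, ∀ b' ∈ P, Λ.Adj b b' → κ x b = κ x b' := by
    intro x hx b hb b' hb' hbb'
    have h1 := hL0 _ (mul_mem hx (hgT b hb (k x b))) b' hb'
      ((hk x hx b hb).mono (Nat.le_succ D))
    rw [hL2' x hx b' hb' b (hPT hb) (Or.inl hbb')] at h1
    exact h1
  have hL3' : ∀ x ∈ subRaag Λ T, ∀ b ∈ P, ∀ b' ∈ P, κ x b = κ x b' := by
    intro x hx b hb b' hb'
    induction hconn b hb b' hb' with
    | refl => rfl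
    | tail _ h ih => rw [ih h.2.1, hL3 x hx _ h.2.1 _ h.2.2 h.1]
  obtain ⟨b, hb⟩ := hne
  have hL4 : ∀ x ∈ subRaag Λ T, κ x b = κ 1 b := by
    refine subRaag_induction rfl fun x hx a ha s hs ih => ?_
    obtain ⟨b', hb', hab⟩ := hdom a ha
    rw [← ih, hL3' _ (mul_mem hx (hs.mem_subRaag ha)) b hb b' hb', hL3' x hx b hb b' hb',
      hL2 x hx b' hb' a ha s hs hab.symm]
  rw [hL0 x hx b hb hxD, hL0 y hy b hb hyD, hL4 x hx, hL4 y hy]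

end Counting

/-! ### Connectivity inside a set of vertices -/

section Reach

variable {V : Type} {Γ : SimpleGraph V} {S T : Set V}

/-- `a` and `b` are joined by a path inside `S`. -/
def Rch (Γ : SimpleGraph V) (S : Set V) (a b : V) : Prop :=
  Relation.ReflTransGen (fun p q => Γ.Adj p q ∧ p ∈ S ∧ q ∈ S) a b

theorem Rch.symm {a b : V} (h : Rch Γ S a b) : Rch Γ S b a := by
  induction h with
  | refl => exact Relation.ReflTransGen.refl
  | tail _ h ih => exact Relation.ReflTransGen.head ⟨h.1.symm, h.2.2, h.2.1⟩ ih

theorem Rch.trans {a b c : V} (h : Rch Γ S a b) (h' : Rch Γ S b c) : Rch Γ S a c :=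
  Relation.ReflTransGen.trans h h'

theorem Rch.single {a b : V} (h : Γ.Adj a b) (ha : a ∈ S) (hb : b ∈ S) : Rch Γ S a b :=
  Relation.ReflTransGen.single ⟨h, ha, hb⟩

theorem Rch.mono {a b : V} (hST : S ⊆ T) (h : Rch Γ S a b) : Rch Γ T a b := by
  induction h with
  | refl => exact Relation.ReflTransGen.refl
  | tail _ h ih => exact ih.tail ⟨h.1, hST h.2.1, hST h.2.2⟩

theorem Rch.mem {a b : V} (h : Rch Γ S a b) (ha : a ∈ S) : b ∈ S := by
  induction h with
  | refl => exact ha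
  | tail _ h _ => exact h.2.2

theorem reachable_induce_iff (a b : S) :
    (Γ.induce S).Reachable a b ↔ Rch Γ S a b := by
  rw [SimpleGraph.reachable_iff_reflTransGen]
  constructor
  · intro h
    induction h with
    | refl => exact Relation.ReflTransGen.refl
    | @tail p q _ h ih => exact ih.tail ⟨h, p.2, q.2⟩
  · intro h
    obtain ⟨b, hb⟩ := b
    change Relation.ReflTransGen _ (a : V) b at h
    induction h with
    | refl => exact Relation.ReflTransGen.refl
    | tail _ h ih => exact (ih h.2.1).tail h.1

theorem preconnected_induce_iff :
    (Γ.induce S).Preconnected ↔ ∀ a ∈ S, ∀ b ∈ S, Rch Γ S a b := by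
  constructor
  · intro h a ha b hb
    exact (reachable_induce_iff ⟨a, ha⟩ ⟨b, hb⟩).mp (h _ _)
  · intro h a b
    exact (reachable_induce_iff a b).mpr (h a a.2 b b.2)

theorem biconn_iff : Biconn Γ S ↔ S.Nonempty ∧ (∀ a ∈ S, ∀ b ∈ S, Rch Γ S a b) ∧
    ∀ x ∈ S, ∀ a ∈ S \ {x}, ∀ b ∈ S \ {x}, Rch Γ (S \ {x}) a b := by
  unfold Biconn
  rw [SimpleGraph.connected_iff, preconnected_induce_iff, Set.nonempty_coe_sort]
  simp only [preconnected_induce_iff]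
  tauto

theorem exists_adj_of_rch {a b : V} (h : Rch Γ S a b) (hab : a ≠ b) :
    ∃ z ∈ S, Γ.Adj a z := by
  rcases Relation.ReflTransGen.cases_head h with h | ⟨z, h, _⟩
  · exact absurd h hab
  · exact ⟨z, h.2.2, h.1⟩

/-- The vertices of `T` other than `b₀` with two distinct nonadjacent neighbours in `T`. -/
def pivots (Γ : SimpleGraph V) (T : Set V) (b₀ : V) : Set V :=
  {b | b ∈ T ∧ b ≠ b₀ ∧ ∃ a ∈ T, ∃ c ∈ T, a ≠ c ∧ ¬ Γ.Adj a c ∧ Γ.Adj b a ∧ Γ.Adj b c}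

theorem adj_of_not_pivot {b₀ b a c : V} (hb : b ∈ T) (hb0 : b ≠ b₀) (h : b ∉ pivots Γ T b₀)
    (ha : a ∈ T) (hc : c ∈ T) (hba : Γ.Adj b a) (hbc : Γ.Adj b c) : c = a ∨ Γ.Adj c a := by
  by_contra! hcon
  exact h ⟨hb, hb0, a, ha, c, hc, Ne.symm hcon.1, fun h => hcon.2 h.symm, hba, hbc⟩

theorem Biconn.rch_diff (hT : Biconn Γ T) (b₀ : V) {a b : V} (ha : a ∈ T) (ha0 : a ≠ b₀)
    (hb : b ∈ T) (hb0 : b ≠ b₀) : Rch Γ (T \ {b₀}) a b := by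
  rw [biconn_iff] at hT
  by_cases h : b₀ ∈ T
  · exact hT.2.2 b₀ h a ⟨ha, ha0⟩ b ⟨hb, hb0⟩
  · rw [Set.sdiff_singleton_eq_self h]
    exact hT.2.1 a ha b hb

theorem pivots_nonempty (hT : Biconn Γ T) (hcl : ¬ Γ.IsClique T) (b₀ : V) :
    (pivots Γ T b₀).Nonempty := by
  by_contra hP
  rw [Set.not_nonempty_iff_eq_empty] at hP
  have key : ∀ x ∈ T, ∀ w ∈ T, w ≠ b₀ → (w = x ∨ Γ.Adj w x) → ∀ z, Rch Γ (T \ {b₀}) w z →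
      (z = x ∨ Γ.Adj z x) := by
    intro x hx w hw hw0 hwx z hz
    induction hz with
    | refl => exact hwx
    | @tail y z _ hyz ih =>
      obtain ⟨hadj, hy, hz⟩ := hyz
      rcases ih with rfl | hyx
      · exact Or.inr hadj.symm
      · exact adj_of_not_pivot hy.1 hy.2 (by rw [hP]; exact Set.notMem_empty _) hx hz.1 hyx hadj
  apply hcl
  intro a ha c hc hac
  have main : ∀ a ∈ T, ∀ c ∈ T, a ≠ c → c ≠ b₀ → Γ.Adj c a := by
    intro a ha c hc hac hc0
    have : ∃ w ∈ T, w ≠ b₀ ∧ (w = a ∨ Γ.Adj w a) := by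
      by_cases ha0 : a = b₀
      · obtain ⟨z, hz, haz⟩ := exists_adj_of_rch ((biconn_iff.mp hT).2.1 a ha c hc) hac
        exact ⟨z, hz, fun h => haz.ne (ha0.trans h.symm), Or.inr haz.symm⟩
      · exact ⟨a, ha, ha0, Or.inl rfl⟩
    obtain ⟨w, hw, hw0, hwa⟩ := this
    exact (key a ha w hw hw0 hwa c (hT.rch_diff b₀ hw hw0 hc hc0)).resolve_left (Ne.symm hac)
  by_cases hc0 : c = b₀
  · exact main c hc a ha hac.symm fun h => hac (h.trans hc0.symm)
  · exact (main a ha c hc hac hc0).symm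

theorem pivots_reach (hT : Biconn Γ T) (b₀ : V) {b : V} (hb : b ∈ pivots Γ T b₀) {z : V}
    (hz : z ∈ T) (hz0 : z ≠ b₀) :
    ∃ p ∈ pivots Γ T b₀, Rch Γ (pivots Γ T b₀) b p ∧ (z = p ∨ Γ.Adj z p) := by
  have h := hT.rch_diff b₀ hb.1 hb.2.1 hz hz0
  clear hz hz0
  induction h with
  | refl => exact ⟨b, hb, Relation.ReflTransGen.refl, Or.inl rfl⟩
  | @tail y z _ hyz ih =>
    obtain ⟨hadj, hy, hz⟩ := hyz
    obtain ⟨p, hp, hbp, rfl | hyp⟩ := ih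
    · exact ⟨y, hp, hbp, Or.inr hadj.symm⟩
    · by_cases hyP : y ∈ pivots Γ T b₀
      · exact ⟨y, hyP, hbp.trans (Rch.single hyp.symm hp hyP), Or.inr hadj.symm⟩
      · exact ⟨p, hp, hbp, adj_of_not_pivot hy.1 hy.2 hyP hp.1 hz.1 hyp hadj⟩

theorem pivots_connected (hT : Biconn Γ T) (b₀ : V) {b b' : V} (hb : b ∈ pivots Γ T b₀)
    (hb' : b' ∈ pivots Γ T b₀) : Rch Γ (pivots Γ T b₀) b b' := by
  obtain ⟨p, hp, hbp, rfl | h⟩ := pivots_reach hT b₀ hb hb'.1 hb'.2.1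
  · exact hbp
  · exact hbp.trans (Rch.single h.symm hp hb')

theorem pivots_dominate (hT : Biconn Γ T) (hcl : ¬ Γ.IsClique T) (b₀ : V) {s : V} (hs : s ∈ T) :
    ∃ b ∈ pivots Γ T b₀, s = b ∨ Γ.Adj s b := by
  obtain ⟨b, hb⟩ := pivots_nonempty hT hcl b₀
  by_cases hs0 : s = b₀
  · obtain ⟨z, hz, hsz⟩ := exists_adj_of_rch ((biconn_iff.mp hT).2.1 s hs b hb.1)
      (fun h => hb.2.1 (h.symm.trans hs0))
    have hz0 : z ≠ b₀ := fun h => hsz.ne (hs0.trans h.symm)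
    by_cases hzP : z ∈ pivots Γ T b₀
    · exact ⟨z, hzP, Or.inr hsz⟩
    · obtain ⟨p, hp, _, rfl | hzp⟩ := pivots_reach hT b₀ hb hz hz0
      · exact absurd hp hzP
      · exact ⟨p, hp, adj_of_not_pivot hz hz0 hzP hp.1 hs hzp hsz.symm⟩
  · obtain ⟨p, hp, _, h⟩ := pivots_reach hT b₀ hb hs hs0
    exact ⟨p, hp, h⟩

end Reach

/-! ### Three rays do not fit in a line -/

section Rays

theorem exists_near_of_unbounded {k : ℕ → ℤ} {s : ℕ} (hk : ∀ n, (k (n + 1) - k n).natAbs ≤ s)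
    {N : ℕ} {b : ℤ} (hN : k N ≤ b) (hunb : ∃ n ≥ N, b ≤ k n) :
    ∃ n ≥ N, (k n - b).natAbs ≤ s := by
  obtain ⟨n, hn, hbn⟩ := hunb
  induction n, hn using Nat.le_induction with
  | base => exact ⟨N, le_rfl, by omega⟩
  | succ n hn ih =>
    by_cases h : b ≤ k n
    · exact ih h
    · exact ⟨n + 1, by omega, by have := hk n; omega⟩

theorem false_of_two_rays {k l : ℕ → ℤ} {s N M B : ℕ} (hB : (k 0).natAbs ≤ B ∧ (l 0).natAbs ≤ B)
    (hk : ∀ n, (k (n + 1) - k n).natAbs ≤ s) (hl : ∀ n, (l (n + 1) - l n).natAbs ≤ s)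
    (hk0 : ∀ n, n ≤ M * ((k n - k 0).natAbs + 1)) (hl0 : ∀ n, n ≤ M * ((l n - l 0).natAbs + 1))
    (hkl : ∀ n m, n + m ≤ M * ((k n - l m).natAbs + 1)) (hN : M * (s + 1) < N)
    (hkpos : ∀ n ≥ N, 0 < k n) (hlpos : ∀ n ≥ N, 0 < l n) : False := by
  have main : ∀ {k l : ℕ → ℤ}, (k 0).natAbs ≤ B →
      (∀ n, (k (n + 1) - k n).natAbs ≤ s) →
      (∀ n, n ≤ M * ((k n - k 0).natAbs + 1)) →
      (∀ n m, n + m ≤ M * ((k n - l m).natAbs + 1)) →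
      (∀ n ≥ N, 0 < k n) → k N ≤ l N → False := by
    intro k l hB hk hk0 hkl hkpos hle
    obtain ⟨n, hn, hnear⟩ := exists_near_of_unbounded hk hle (by
      refine ⟨N + M * ((l N).natAbs + B + 1) + 1, by omega, ?_⟩
      set n := N + M * ((l N).natAbs + B + 1) + 1 with hn
      by_contra! hcon
      have h1 := hkpos n (by omega)
      have h2 := hk0 n
      have h3 : (k n - k 0).natAbs + 1 ≤ (l N).natAbs + B + 1 := by omega
      have h4 := Nat.mul_le_mul_left M h3
      omega)
    have h1 := hkl n N
    have h2 := Nat.mul_le_mul_left M (Nat.succ_le_succ hnear)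
    simp only [Nat.succ_eq_add_one] at h2
    omega
  rcases le_total (k N) (l N) with h | h
  · exact main hB.1 hk hk0 hkl hkpos h
  · refine main hB.2 hl hl0 (fun n m => ?_) hlpos h
    rw [← Int.natAbs_neg, neg_sub, add_comm]
    exact hkl m n

theorem eventually_sign {k : ℕ → ℤ} {s N : ℕ} (hk : ∀ n, (k (n + 1) - k n).natAbs ≤ s)
    (hfar : ∀ n ≥ N, s < (k n).natAbs) : (∀ n ≥ N, 0 < k n) ∨ (∀ n ≥ N, 0 < - k n) := by
  rcases lt_or_ge 0 (k N) with h | h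
  · left
    intro n hn
    induction n, hn using Nat.le_induction with
    | base => exact h
    | succ n hn ih =>
      have h1 := hk n
      have h2 := hfar n hn
      have h3 := hfar (n + 1) (by omega)
      omega
  · right
    intro n hn
    induction n, hn using Nat.le_induction with
    | base => have := hfar N le_rfl; omega
    | succ n hn ih =>
      have h1 := hk n
      have h2 := hfar n hn
      have h3 := hfar (n + 1) (by omega)
      omega

theorem false_of_three_int_rays {k : Fin 3 → ℕ → ℤ} {s M : ℕ}
    (hk : ∀ i n, (k i (n + 1) - k i n).natAbs ≤ s)
    (hk0 : ∀ i n, n ≤ M * ((k i n - k i 0).natAbs + 1))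
    (hkl : ∀ i j, i ≠ j → ∀ n m, n + m ≤ M * ((k i n - k j m).natAbs + 1)) : False := by
  obtain ⟨B, hB⟩ : ∃ B : ℕ, ∀ i, (k i 0).natAbs ≤ B :=
    ⟨(k 0 0).natAbs + (k 1 0).natAbs + (k 2 0).natAbs, fun i => by fin_cases i <;> simp <;> omega⟩
  set N := M * (s + B + 1) + 1 with hN
  have hMN : M * (s + 1) < N := by
    have := Nat.mul_le_mul_left M (show s + 1 ≤ s + B + 1 by omega)
    omega
  have hsign : ∀ i, (∀ n ≥ N, 0 < k i n) ∨ (∀ n ≥ N, 0 < - k i n) := by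
    intro i
    refine eventually_sign (hk i) fun n hn => ?_
    by_contra! hcon
    have h1 := hk0 i n
    have h2 := hB i
    have h3 : (k i n - k i 0).natAbs + 1 ≤ s + B + 1 := by omega
    have h4 := Nat.mul_le_mul_left M h3
    omega
  have hneg : ∀ x y : ℤ, (-x - -y).natAbs = (x - y).natAbs := fun x y => by omega
  have hfin : ∀ i j, i ≠ j → ¬ ((∀ n ≥ N, 0 < k i n) ∧ (∀ n ≥ N, 0 < k j n)) ∧
      ¬ ((∀ n ≥ N, 0 < - k i n) ∧ (∀ n ≥ N, 0 < - k j n)) := by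
    intro i j hij
    refine ⟨fun h => false_of_two_rays ⟨hB i, hB j⟩ (hk i) (hk j) (hk0 i) (hk0 j)
      (hkl i j hij) hMN h.1 h.2, fun h => ?_⟩
    refine false_of_two_rays (k := fun n => - k i n) (l := fun n => - k j n) (s := s) (N := N)
      (M := M) (B := B) ⟨?_, ?_⟩ (fun n => ?_) (fun n => ?_) (fun n => ?_) (fun n => ?_)
      (fun n m => ?_) hMN h.1 h.2
    · simpa using hB i
    · simpa using hB j
    · rw [hneg]; exact hk i n
    · rw [hneg]; exact hk j n
    · rw [hneg]; exact hk0 i n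
    · rw [hneg]; exact hk0 j n
    · rw [hneg]; exact hkl i j hij n m
  have h01 := hfin 0 1 (by decide)
  have h02 := hfin 0 2 (by decide)
  have h12 := hfin 1 2 (by decide)
  have h0 := hsign 0
  have h1 := hsign 1
  have h2 := hsign 2
  tauto

variable {V W : Type} {Γ : SimpleGraph V} {Λ : SimpleGraph W}

/-- `F` is a quasi-isometric embedding on `A` with natural number constant `K`. -/
def QIEOn (K : ℕ) (A : Set (Raag Λ)) (F : Raag Λ → Raag Γ) : Prop :=
  ∀ x ∈ A, ∀ y ∈ A, nd (F x) (F y) ≤ K * nd x y + K ∧ nd x y ≤ K * nd (F x) (F y) + K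

theorem QIEOn.mono {K : ℕ} {A B : Set (Raag Λ)} {F : Raag Λ → Raag Γ} (h : QIEOn K A F)
    (hBA : B ⊆ A) : QIEOn K B F := fun x hx y hy => h x (hBA hx) y (hBA hy)

theorem QIEOn.nd_le_of_nd_le {K : ℕ} {A : Set (Raag Λ)} {F : Raag Λ → Raag Γ} (h : QIEOn K A F)
    {x y : Raag Λ} (hx : x ∈ A) (hy : y ∈ A) {n : ℕ} (hn : nd x y ≤ n) :
    nd (F x) (F y) ≤ K * n + K :=
  (h x hx y hy).1.trans (Nat.add_le_add_right (Nat.mul_le_mul_left K hn) K)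

theorem QIEOn.nd_le_of_nd_le' {K : ℕ} {A : Set (Raag Λ)} {F : Raag Λ → Raag Γ} (h : QIEOn K A F)
    {x y : Raag Λ} (hx : x ∈ A) (hy : y ∈ A) {n : ℕ} (hn : nd (F x) (F y) ≤ n) :
    nd x y ≤ K * n + K :=
  (h x hx y hy).2.trans (Nat.add_le_add_right (Nat.mul_le_mul_left K hn) K)

theorem nd_quad (x y x' y' : Raag Γ) : nd x y ≤ nd x x' + nd x' y' + nd y y' := by
  have h1 := nd_triangle x x' y
  have h2 := nd_triangle x' y' y
  rw [nd_comm y' y] at h2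
  omega

theorem false_of_three_rays {K : ℕ} {A : Set (Raag Λ)} {F : Raag Λ → Raag Γ} (hF : QIEOn K A F)
    {g : Raag Γ} {v : V} {R c : ℕ} {r : Fin 3 → ℕ → Raag Λ} (hrA : ∀ i n, r i n ∈ A)
    (hstep : ∀ i n, nd (r i n) (r i (n + 1)) ≤ 1)
    (hself : ∀ i n, n ≤ nd (r i n) (r i 0) + c)
    (hdiv : ∀ i j, i ≠ j → ∀ n m, n + m ≤ nd (r i n) (r j m) + c)
    (hnear : ∀ i n, ∃ k : ℤ, nd (F (r i n)) (g * raagGen Γ v ^ k) ≤ R) : False := by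
  choose k hk using hnear
  have hup : ∀ i j n m, nd (r i n) (r j m) ≤ K * ((k i n - k j m).natAbs + 2 * R) + K := by
    intro i j n m
    refine hF.nd_le_of_nd_le' (hrA i n) (hrA j m) ?_
    have h1 := nd_quad (F (r i n)) (F (r j m)) (g * raagGen Γ v ^ k i n) (g * raagGen Γ v ^ k j m)
    rw [nd_gen_zpow] at h1
    have h2 := hk i n
    have h3 := hk j m
    omega
  have hup' : ∀ i j n m, nd (r i n) (r j m) + c ≤
      (2 * K * R + K + c) * ((k i n - k j m).natAbs + 1) := by
    intro i j n m
    have := hup i j n m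
    nlinarith [Nat.zero_le (K * R * (k i n - k j m).natAbs),
      Nat.zero_le (c * (k i n - k j m).natAbs)]
  refine false_of_three_int_rays (k := k) (s := 2 * K + 2 * R) (M := 2 * K * R + K + c)
    (fun i n => ?_) (fun i n => (hself i n).trans (hup' i i n 0))
    (fun i j hij n m => (hdiv i j hij n m).trans (hup' i j n m))
  have h1 := nd_quad (g * raagGen Γ v ^ k i n) (g * raagGen Γ v ^ k i (n + 1)) (F (r i n))
    (F (r i (n + 1)))
  rw [nd_gen_zpow] at h1
  have h2 := hk i n
  have h3 := hk i (n + 1)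
  rw [nd_comm] at h2 h3
  have h4 := hF.nd_le_of_nd_le (hrA i n) (hrA i (n + 1)) (hstep i n)
  omega

theorem nd_gen_pow_succ (x : Raag Λ) (b : W) (e : ℤ) (he : e.natAbs = 1) (n : ℕ) :
    nd (x * raagGen Λ b ^ (e * (n : ℤ))) (x * raagGen Λ b ^ (e * ((n + 1 : ℕ) : ℤ))) ≤ 1 := by
  rw [nd_gen_zpow]
  push_cast
  ring_nf
  omega

theorem nd_gen_pow_zero (x : Raag Λ) (b : W) (e : ℤ) (he : e.natAbs = 1) (n : ℕ) :
    nd (x * raagGen Λ b ^ (e * (n : ℤ))) (x * raagGen Λ b ^ (e * ((0 : ℕ) : ℤ))) = n := by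
  rw [nd_gen_zpow]
  push_cast
  rw [mul_zero, zero_sub, Int.natAbs_neg, Int.natAbs_mul, he, one_mul, Int.natAbs_natCast]

/-- A line together with a third ray diverging from both of its ends cannot be mapped into a
neighbourhood of a line. -/
theorem false_of_line_and_ray {K : ℕ} {A : Set (Raag Λ)} {F : Raag Λ → Raag Γ} (hF : QIEOn K A F)
    {g : Raag Γ} {v : V} {R c : ℕ} {x x' : Raag Λ} {b b' : W}
    (hxA : ∀ k : ℤ, x * raagGen Λ b ^ k ∈ A) (hxA' : ∀ k : ℤ, x' * raagGen Λ b' ^ k ∈ A)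
    (hdiv : ∀ n m : ℤ, n.natAbs + m.natAbs ≤
      nd (x * raagGen Λ b ^ n) (x' * raagGen Λ b' ^ m) + c)
    (hx : ∀ n : ℤ, ∃ k : ℤ, nd (F (x * raagGen Λ b ^ n)) (g * raagGen Γ v ^ k) ≤ R)
    (hx' : ∀ n : ℤ, ∃ k : ℤ, nd (F (x' * raagGen Λ b' ^ n)) (g * raagGen Γ v ^ k) ≤ R) :
    False := by
  have e1 : (1 : ℤ).natAbs = 1 := rfl
  have e2 : (-1 : ℤ).natAbs = 1 := rfl
  refine false_of_three_rays hF (g := g) (v := v) (R := R) (c := c)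
    (r := ![fun n => x * raagGen Λ b ^ ((1 : ℤ) * (n : ℤ)),
      fun n => x * raagGen Λ b ^ ((-1 : ℤ) * (n : ℤ)),
      fun n => x' * raagGen Λ b' ^ ((1 : ℤ) * (n : ℤ))]) ?_ ?_ ?_ ?_ ?_
  · intro i n
    fin_cases i
    exacts [hxA _, hxA _, hxA' _]
  · intro i n
    fin_cases i
    exacts [nd_gen_pow_succ _ _ _ e1 n, nd_gen_pow_succ _ _ _ e2 n, nd_gen_pow_succ _ _ _ e1 n]
  · intro i n
    fin_cases i
    · exact (nd_gen_pow_zero x b 1 e1 n).ge.trans (Nat.le_add_right _ _)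
    · exact (nd_gen_pow_zero x b (-1) e2 n).ge.trans (Nat.le_add_right _ _)
    · exact (nd_gen_pow_zero x' b' 1 e1 n).ge.trans (Nat.le_add_right _ _)
  · have h01 : ∀ n m : ℕ, n + m ≤ nd (x * raagGen Λ b ^ ((1 : ℤ) * (n : ℤ)))
        (x * raagGen Λ b ^ ((-1 : ℤ) * (m : ℤ))) + c := by
      intro n m
      rw [nd_gen_zpow]
      omega
    have h02 : ∀ e : ℤ, e.natAbs = 1 → ∀ n m : ℕ, n + m ≤ nd (x * raagGen Λ b ^ (e * (n : ℤ)))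
        (x' * raagGen Λ b' ^ ((1 : ℤ) * (m : ℤ))) + c := by
      intro e he n m
      have := hdiv (e * n) (1 * m)
      rwa [Int.natAbs_mul, he, Int.natAbs_mul, e1, one_mul, one_mul, Int.natAbs_natCast,
        Int.natAbs_natCast] at this
    intro i j hij n m
    fin_cases i <;> fin_cases j
    · exact absurd rfl hij
    · exact h01 n m
    · exact h02 1 e1 n m
    · rw [nd_comm, add_comm n m]; exact h01 m n
    · exact absurd rfl hij
    · exact h02 (-1) e2 n m
    · rw [nd_comm, add_comm n m]; exact h02 1 e1 m n
    · rw [nd_comm, add_comm n m]; exact h02 (-1) e2 m n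
    · exact absurd rfl hij
  · intro i n
    fin_cases i
    exacts [hx _, hx _, hx' _]

theorem false_of_two_labels {K : ℕ} {A : Set (Raag Λ)} {F : Raag Λ → Raag Γ} (hF : QIEOn K A F)
    {g : Raag Γ} {v : V} {R : ℕ} {x x' : Raag Λ} {b b' : W} (hbb' : b ≠ b')
    (hxA : ∀ k : ℤ, x * raagGen Λ b ^ k ∈ A) (hxA' : ∀ k : ℤ, x' * raagGen Λ b' ^ k ∈ A)
    (hx : ∀ n : ℤ, ∃ k : ℤ, nd (F (x * raagGen Λ b ^ n)) (g * raagGen Γ v ^ k) ≤ R)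
    (hx' : ∀ n : ℤ, ∃ k : ℤ, nd (F (x' * raagGen Λ b' ^ n)) (g * raagGen Γ v ^ k) ≤ R) :
    False := by
  refine false_of_line_and_ray hF
    (c := (expoZ b (x⁻¹ * x')).natAbs + (expoZ b' (x⁻¹ * x')).natAbs) hxA hxA' ?_ hx hx'
  intro n m
  have h := natAbs_expoZ_add_le hbb' ((x * raagGen Λ b ^ n)⁻¹ * (x' * raagGen Λ b' ^ m))
  have e : (x * raagGen Λ b ^ n)⁻¹ * (x' * raagGen Λ b' ^ m) =
      raagGen Λ b ^ (-n) * ((x⁻¹ * x') * raagGen Λ b' ^ m) := by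
    rw [mul_inv_rev, zpow_neg]; group
  unfold nd
  rw [e] at h ⊢
  simp only [expoZ_mul, expoZ_zpow, expoZ_gen_self, expoZ_gen_ne hbb', expoZ_gen_ne hbb'.symm]
    at h ⊢
  omega

end Rays

/-! ### Lines do not separate the images of biconnected subgraphs -/

section NonSeparation

variable {V W : Type} {Γ : SimpleGraph V} {Λ : SimpleGraph W}

/-- The point `y` is at distance more than `R` from the line `g⟨v⟩`. -/
def FarLine (R : ℕ) (g : Raag Γ) (v : V) (y : Raag Γ) : Prop :=
  ∀ k : ℤ, R < nd y (g * raagGen Γ v ^ k)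

theorem FarLine.mono {R S : ℕ} {g y : Raag Γ} {v : V} (h : FarLine R g v y) (hSR : S ≤ R) :
    FarLine S g v y := fun k => hSR.trans_lt (h k)

theorem FarLine.of_near {R n : ℕ} {g y y' : Raag Γ} {v : V} (h : FarLine (R + n) g v y)
    (hn : nd y y' ≤ n) : FarLine R g v y' := by
  intro k
  have h1 := h k
  have h2 := nd_triangle y y' (g * raagGen Γ v ^ k)
  omega

theorem not_farLine {R : ℕ} {g y : Raag Γ} {v : V} :
    ¬ FarLine R g v y ↔ ∃ k : ℤ, nd y (g * raagGen Γ v ^ k) ≤ R := by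
  simp [FarLine]

theorem FarLine.not_mem {R : ℕ} {g y : Raag Γ} {v : V} (h : FarLine R g v y) :
    g⁻¹ * y ∉ lineOf Γ v := by
  intro h'
  obtain ⟨k, hk⟩ := mem_lineOf.mp h'
  have := h k
  rw [hk, mul_inv_cancel_left, nd_self] at this
  omega

variable {v : V} {I : Set V} {T : Set W} {F : Raag Λ → Raag Γ} {K : ℕ}

theorem ClosedOff.col_eq_of_near (hI : ClosedOff Γ v I) {g y y' : Raag Γ} {n : ℕ}
    (h : FarLine n g v y) (hn : nd y y' ≤ n) : hI.col (g⁻¹ * y') = hI.col (g⁻¹ * y) := by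
  refine eq_of_far (c := fun y => hI.col (g⁻¹ * y))
    (Z := Set.range fun k : ℤ => g * raagGen Γ v ^ k) ?_ (n := n) ?_ hn
  · intro z a s hs hz hzs
    rw [← mul_assoc]
    refine hI.col_edge hs ?_ ?_
    · intro h'
      obtain ⟨k, hk⟩ := mem_lineOf.mp h'
      exact hz ⟨k, by simp only [hk, mul_inv_cancel_left]⟩
    · intro h'
      obtain ⟨k, hk⟩ := mem_lineOf.mp h'
      exact hzs ⟨k, by simp only [hk]; group⟩
  · rintro _ ⟨k, rfl⟩
    exact h k

theorem linGrowth_nearLine [Finite W] (hF : QIEOn K (subRaag Λ T) F) (v : V) (R : ℕ) :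
    ∃ C, ∀ g : Raag Γ, LinGrowth {y | y ∈ subRaag Λ T ∧ ¬ FarLine R g v (F y)} C := by
  classical
  set B := (finite_wlen_le (Γ := Λ) (K * (2 * R) + K)).toFinset.card with hB
  refine ⟨B * (4 * R + 6 * K + 1), fun g x r Z hZ => ?_⟩
  have hex : ∀ z ∈ Z, ∃ k : ℤ, nd (F z) (g * raagGen Γ v ^ k) ≤ R := fun z hz =>
    not_farLine.mp (hZ z hz).1.2
  choose! j hj using hex
  have hdist : ∀ z ∈ Z, ∀ z' ∈ Z, (j z - j z').natAbs ≤ 2 * R + (K * (2 * r) + K) := by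
    intro z hz z' hz'
    have h1 := nd_quad (g * raagGen Γ v ^ j z) (g * raagGen Γ v ^ j z') (F z) (F z')
    rw [nd_gen_zpow] at h1
    have h2 := hj z hz
    have h3 := hj z' hz'
    rw [nd_comm] at h2 h3
    have h4 := hF.nd_le_of_nd_le (hZ z hz).1.1 (hZ z' hz').1.1 (n := 2 * r) (by
      have h5 := nd_triangle z x z'
      have h6 := (hZ z hz).2
      have h7 := (hZ z' hz').2
      rw [nd_comm] at h6
      omega)
    omega
  have hfib : ∀ a ∈ Z.image j, (Z.filter fun z => j z = a).card ≤ B := by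
    intro a ha
    obtain ⟨z, hz, rfl⟩ := Finset.mem_image.mp ha
    rw [← Finset.card_image_of_injective _ (mul_right_injective z⁻¹)]
    refine Finset.card_le_card fun u hu => ?_
    obtain ⟨z', hz', rfl⟩ := Finset.mem_image.mp hu
    rw [Finset.mem_filter] at hz'
    rw [Set.Finite.mem_toFinset]
    refine hF.nd_le_of_nd_le' (hZ z hz).1.1 (hZ z' hz'.1).1.1 ?_
    have h1 := nd_triangle (F z) (g * raagGen Γ v ^ j z) (F z')
    have h2 := hj z hz
    have h3 := hj z' hz'.1
    rw [hz'.2, nd_comm] at h3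
    omega
  have h1 := Finset.card_le_mul_card_image Z B hfib
  refine h1.trans ?_
  rw [mul_assoc]
  refine Nat.mul_le_mul_left B ?_
  rcases Z.eq_empty_or_nonempty with rfl | ⟨z, hz⟩
  · simp
  · have h2 : Z.image j ⊆ Finset.Icc (j z - ((2 * R + (K * (2 * r) + K) : ℕ) : ℤ))
        (j z + ((2 * R + (K * (2 * r) + K) : ℕ) : ℤ)) := by
      intro a ha
      obtain ⟨z', hz', rfl⟩ := Finset.mem_image.mp ha
      have := hdist z hz z' hz'
      rw [Finset.mem_Icc]
      omega
    have h3 := Finset.card_le_card h2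
    rw [Int.card_Icc] at h3
    have h4 : (Z.image j).card ≤ 2 * (2 * R + (K * (2 * r) + K)) + 1 := by omega
    refine h4.trans ?_
    nlinarith [Nat.zero_le (R * r), Nat.zero_le (K * r)]

/-- The conditions on a set of labels needed for the separation argument. -/
structure PivotSet (Λ : SimpleGraph W) (T P : Set W) : Prop where
  subset : P ⊆ T
  fork : ∀ b ∈ P, ∃ a ∈ T, ∃ c ∈ T, a ≠ c ∧ ¬ Λ.Adj a c ∧ Λ.Adj b a ∧ Λ.Adj b c
  reach : ∀ b ∈ P, ∀ b' ∈ P, Rch Λ P b b'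
  dominate : ∀ s ∈ T, ∃ b ∈ P, s = b ∨ Λ.Adj s b
  nonempty : P.Nonempty

theorem pivotSet_pivots (hT : Biconn Λ T) (hcl : ¬ Λ.IsClique T) (b₀ : W) :
    PivotSet Λ T (pivots Λ T b₀) where
  subset _ hb := hb.1
  fork _ hb := hb.2.2
  reach _ hb _ hb' := pivots_connected hT b₀ hb hb'
  dominate _ hs := pivots_dominate hT hcl b₀ hs
  nonempty := pivots_nonempty hT hcl b₀

theorem pivotSet_singleton {u : W} (hu : u ∈ T) (hTu : T ⊆ starSet Λ u)
    (hcl : ¬ Λ.IsClique T) : PivotSet Λ T {u} where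
  subset := by simpa using hu
  fork := by
    rintro b rfl
    by_contra! hcon
    apply hcl
    intro a ha c hc hac
    rcases hTu ha with rfl | ha' <;> rcases hTu hc with rfl | hc'
    · exact absurd rfl hac
    · exact hc'
    · exact ha'.symm
    · by_contra h
      exact hcon a ha c hc hac h ha' hc'
  reach := by
    rintro b rfl b' rfl
    exact Relation.ReflTransGen.refl
  dominate s hs := ⟨u, rfl, by
    rcases hTu hs with h | h
    · exact Or.inl h
    · exact Or.inr h.symm⟩
  nonempty := ⟨u, rfl⟩

/-- All points of the image far away from `g⟨v⟩` are on the same side. -/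
def OneSided (hI : ClosedOff Γ v I) (A : Set (Raag Λ)) (F : Raag Λ → Raag Γ) (R : ℕ)
    (g : Raag Γ) : Prop :=
  ∃ ε : ℤ, ∀ x ∈ A, FarLine R g v (F x) → hI.col (g⁻¹ * F x) = ε

theorem exists_oneSided [Finite W] (hF : QIEOn K (subRaag Λ T) F) (hI : ClosedOff Γ v I) :
    ∃ R, ∀ g, ∀ P, PivotSet Λ T P →
      (∀ x ∈ subRaag Λ T, ∀ b ∈ P, ∃ k : ℤ, FarLine R g v (F (x * raagGen Λ b ^ k))) →
      OneSided hI (subRaag Λ T) F R g := by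
  obtain ⟨C, hC⟩ := linGrowth_nearLine hF v (2 * K)
  obtain ⟨D, hD⟩ := exists_depth C
  refine ⟨K * (D + 1) + K + 2 * K, fun g P hP hlines => ?_⟩
  set Y := {y | y ∈ subRaag Λ T ∧ ¬ FarLine (2 * K) g v (F y)} with hY
  have hdeep : ∀ x ∈ subRaag Λ T, FarLine (K * (D + 1) + K + 2 * K) g v (F x) →
      Deep Y (D + 1) x := by
    intro x hx hfar y hy
    by_contra! hcon
    obtain ⟨k, hk⟩ := not_farLine.mp hy.2
    have h1 := hF.nd_le_of_nd_le hx hy.1 hcon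
    have h2 := hfar k
    have h3 := nd_triangle (F x) (F y) (g * raagGen Γ v ^ k)
    omega
  have hγ : ∀ z ∈ subRaag Λ T, ∀ a ∈ T, ∀ s, Letter Λ a s → z ∉ Y → z * s ∉ Y →
      hI.col (g⁻¹ * F (z * s)) = hI.col (g⁻¹ * F z) := by
    intro z hz a ha s hs hzY _
    have h1 : FarLine (2 * K) g v (F z) := by
      by_contra h
      exact hzY ⟨hz, h⟩
    refine hI.col_eq_of_near h1 ?_
    have := hF.nd_le_of_nd_le hz (mul_mem hz (hs.mem_subRaag ha)) (nd_letter hs z)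
    omega
  have key : ∀ x ∈ subRaag Λ T, ∀ y ∈ subRaag Λ T,
      FarLine (K * (D + 1) + K + 2 * K) g v (F x) →
      FarLine (K * (D + 1) + K + 2 * K) g v (F y) →
      hI.col (g⁻¹ * F x) = hI.col (g⁻¹ * F y) := by
    intro x hx y hy hxf hyf
    refine eq_of_pivots (γ := fun z => hI.col (g⁻¹ * F z)) (hC g) hD hγ hP.subset hP.fork ?_
      hP.reach hP.dominate hP.nonempty hx hy ((hdeep x hx hxf).mono (Nat.le_succ D))
      ((hdeep y hy hyf).mono (Nat.le_succ D))
    intro x hx b hb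
    obtain ⟨k, hk⟩ := hlines x hx b hb
    exact ⟨k, hdeep _ (mul_mem hx (zpow_mem (raagGen_mem_subRaag (hP.subset hb)) k)) hk⟩
  by_cases hex : ∃ x ∈ subRaag Λ T, FarLine (K * (D + 1) + K + 2 * K) g v (F x)
  · obtain ⟨x, hx, hxf⟩ := hex
    exact ⟨_, fun y hy hyf => key y hy x hx hyf hxf⟩
  · push Not at hex
    exact ⟨0, fun y hy hyf => absurd hyf (hex y hy)⟩

theorem Biconn.exists_oneSided [Finite W] (hT : Biconn Λ T) (hcl : ¬ Λ.IsClique T)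
    (hF : QIEOn K (subRaag Λ T) F) (hI : ClosedOff Γ v I) :
    ∃ R, ∀ g, OneSided hI (subRaag Λ T) F R g := by
  obtain ⟨R, hR⟩ := _root_.exists_oneSided hF hI
  refine ⟨R, fun g => ?_⟩
  have hmem : ∀ x ∈ subRaag Λ T, ∀ b ∈ T, ∀ k : ℤ, x * raagGen Λ b ^ k ∈ subRaag Λ T :=
    fun x hx b hb k => mul_mem hx (zpow_mem (raagGen_mem_subRaag hb) k)
  by_cases hbad : ∃ b ∈ T, ∃ x ∈ subRaag Λ T, ∀ k : ℤ,
      ¬ FarLine R g v (F (x * raagGen Λ b ^ k))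
  · obtain ⟨b₀, hb₀, x₀, hx₀, hbad⟩ := hbad
    refine hR g _ (pivotSet_pivots hT hcl b₀) fun x hx b hb => ?_
    by_contra! hcon
    exact false_of_two_labels hF hb.2.1 (hmem x hx b hb.1) (hmem x₀ hx₀ b₀ hb₀)
      (fun n => not_farLine.mp (hcon n)) (fun n => not_farLine.mp (hbad n))
  · push Not at hbad
    obtain ⟨b₀⟩ : Nonempty W := ((biconn_iff.mp hT).1).to_type
    exact hR g _ (pivotSet_pivots hT hcl b₀) fun x hx b hb => hbad b hb.1 x hx

theorem exists_oneSided_of_star [Finite W] {u : W} (hu : u ∈ T) (hTu : T ⊆ starSet Λ u)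
    (hcl : ¬ Λ.IsClique T) (hF : QIEOn K (subRaag Λ T) F) (hI : ClosedOff Γ v I) :
    ∃ R, ∀ g, OneSided hI (subRaag Λ T) F R g ∨ ∃ x ∈ subRaag Λ T, ∀ k : ℤ,
      ¬ FarLine R g v (F (x * raagGen Λ u ^ k)) := by
  obtain ⟨R, hR⟩ := exists_oneSided hF hI
  refine ⟨R, fun g => ?_⟩
  by_contra! hcon
  refine hcon.1 (hR g {u} (pivotSet_singleton hu hTu hcl) ?_)
  rintro x hx b rfl
  exact hcon.2 x hx

end NonSeparation

/-! ### Cliques do not contain images of nonabelian subgroups -/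

section Growth

variable {V W : Type} {Γ : SimpleGraph V} {Λ : SimpleGraph W}

theorem eq_of_expoZ_eq [Finite V] {S : Set V} (hS : Γ.IsClique S) {x y : Raag Γ}
    (hx : x ∈ subRaag Γ S) (hy : y ∈ subRaag Γ S) (h : ∀ a, expoZ a x = expoZ a y) : x = y := by
  classical
  have := Fintype.ofFinite S
  have hcomm : Pairwise fun a b : S => ∀ m n : Multiplicative ℤ,
      Commute (zpowersHom (Raag Γ) (raagGen Γ (a : V)) m)
        (zpowersHom (Raag Γ) (raagGen Γ (b : V)) n) := by
    intro a b hab m n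
    have hadj : Γ.Adj a b := hS a.2 b.2 fun h => hab (Subtype.ext h)
    exact (((Letter.gen (a : V)).commute (Letter.gen (b : V)) (Or.inl hadj)).zpow_left _).zpow_right _
  set Φ := MonoidHom.noncommPiCoprod (fun a : S => zpowersHom (Raag Γ) (raagGen Γ (a : V))) hcomm
    with hΦ
  set Ψ : Raag Γ →* Raag Γ := Φ.comp (MonoidHom.pi fun a : S => expo (a : V)) with hΨ
  have hfix : ∀ z ∈ subRaag Γ S, Ψ z = z := by
    refine MonoidHom.eqOn_closure (f := Ψ) (g := MonoidHom.id _) ?_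
    rintro _ ⟨b, hb, rfl⟩
    have h1 : (MonoidHom.pi fun a : S => expo (a : V)) (raagGen Γ b) =
        Pi.mulSingle (⟨b, hb⟩ : S) (Multiplicative.ofAdd 1) := by
      funext a
      rcases eq_or_ne a ⟨b, hb⟩ with rfl | hab
      · rw [Pi.mulSingle_eq_same]
        exact expoZ_gen_self (Γ := Γ) b
      · rw [Pi.mulSingle_eq_of_ne hab]
        exact expoZ_gen_ne (Γ := Γ) fun h => hab (Subtype.ext h.symm)
    change Φ _ = raagGen Γ b
    rw [h1, hΦ, MonoidHom.noncommPiCoprod_mulSingle]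
    simp
  rw [← hfix x hx, ← hfix y hy]
  change Φ _ = Φ _
  congr 1
  funext a
  exact h a

theorem exists_pow_lt_two_pow (B a n : ℕ) : ∃ r : ℕ, B * (a * (r + 1)) ^ n < 2 ^ r := by
  have h := tendsto_pow_const_div_const_pow_of_one_lt n (r := (2 : ℝ)) (by norm_num)
  set M : ℝ := B * (a * 2) ^ n with hM
  have hM0 : 0 ≤ M := by positivity
  have hev := (h.eventually (gt_mem_nhds (show (0 : ℝ) < 1 / (M + 1) by positivity))).and
    (Filter.eventually_ge_atTop 1)
  obtain ⟨r, h1, h2⟩ := hev.exists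
  refine ⟨r, ?_⟩
  rw [div_lt_div_iff₀ (by positivity) (by positivity)] at h1
  have h3 : ((B * (a * (r + 1)) ^ n : ℕ) : ℝ) ≤ M * (r : ℝ) ^ n := by
    rw [hM, mul_assoc, ← mul_pow]
    push_cast
    have h2' : (1 : ℝ) ≤ r := by exact_mod_cast h2
    gcongr ?_ * ?_ ^ n
    rw [mul_assoc]
    gcongr
    linarith
  have h4 : ((B * (a * (r + 1)) ^ n : ℕ) : ℝ) < ((2 ^ r : ℕ) : ℝ) := by
    push_cast at h3 ⊢
    nlinarith [pow_nonneg (Nat.cast_nonneg (α := ℝ) r) n]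
  exact_mod_cast h4

/-- The image of `A` lies in the `R`-neighbourhood of `g·A(S)`. -/
def Within (R : ℕ) (g : Raag Γ) (S : Set V) (F : Raag Λ → Raag Γ) (A : Set (Raag Λ)) : Prop :=
  ∀ x ∈ A, ∃ h ∈ subRaag Γ S, nd (F x) (g * h) ≤ R

theorem Within.not_isClique [Finite V] [Finite W] {T : Set W} {S : Set V} {F : Raag Λ → Raag Γ}
    {K R : ℕ} {g : Raag Γ} (hF : QIEOn K (subRaag Λ T) F)
    (h : Within R g S F (subRaag Λ T)) (hT : ¬ Λ.IsClique T) : ¬ Γ.IsClique S := by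
  classical
  have := Fintype.ofFinite V
  intro hS
  obtain ⟨a, ha, c, hc, hac, hac'⟩ : ∃ a ∈ T, ∃ c ∈ T, a ≠ c ∧ ¬ Λ.Adj a c := by
    by_contra! hcon
    exact hT fun a ha c hc hac => hcon a ha c hc hac
  choose! σ hσ hσF using h
  set p := posWord Λ a c with hp
  have hinj : Function.Injective p := posWord_injective hac' hac
  have hpT : ∀ l, p l ∈ subRaag Λ T := posWord_mem ha hc
  set B := (finite_wlen_le (Γ := Λ) (K * (2 * R) + K)).toFinset.card with hB
  set c₀ := R + K + nd (F 1) g with hc₀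
  have hlen : ∀ l : List Bool, wlen (σ (p l)) ≤ K * l.length + c₀ := by
    intro l
    have h1 := hσF (p l) (hpT l)
    have h2 := hF.nd_le_of_nd_le (one_mem _) (hpT l) (n := l.length)
      (by rw [nd_one_left]; exact wlen_posWord_le l)
    have h3 := nd_quad (g * σ (p l)) g (F (p l)) (F 1)
    rw [nd_comm (g * σ (p l)) g, nd_mul_right, nd_comm (g * _), nd_comm g,
      nd_comm (F (p l)) (F 1)] at h3
    omega
  obtain ⟨r, hr⟩ := exists_pow_lt_two_pow B (2 * K + 2 * c₀ + 1) (Fintype.card V)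
  set Z : Finset (List Bool) :=
    (Finset.univ : Finset (List.Vector Bool r)).image List.Vector.toList with hZ
  have hZcard : Z.card = 2 ^ r := by
    rw [hZ, Finset.card_image_of_injective _ List.Vector.toList_injective, Finset.card_univ, card_vector,
      Fintype.card_bool]
  have hZlen : ∀ l ∈ Z, l.length = r := by
    intro l hl
    obtain ⟨w, _, rfl⟩ := Finset.mem_image.mp hl
    exact w.toList_length
  set e : List Bool → V → ℤ := fun l u => expoZ u (σ (p l)) with he
  have hfib : ∀ i ∈ Z.image e, (Z.filter fun l => e l = i).card ≤ B := by
    intro i hi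
    obtain ⟨l, hl, rfl⟩ := Finset.mem_image.mp hi
    rw [← Finset.card_image_of_injective (f := fun l' => (p l)⁻¹ * p l') _
      (fun _ _ h => hinj (mul_left_cancel h))]
    refine Finset.card_le_card fun u hu => ?_
    obtain ⟨l', hl', rfl⟩ := Finset.mem_image.mp hu
    rw [Finset.mem_filter] at hl'
    rw [Set.Finite.mem_toFinset]
    refine hF.nd_le_of_nd_le' (hpT l) (hpT l') ?_
    have h1 : σ (p l') = σ (p l) :=
      eq_of_expoZ_eq hS (hσ _ (hpT l')) (hσ _ (hpT l)) fun u => congrFun hl'.2 u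
    have h2 := nd_triangle (F (p l)) (g * σ (p l)) (F (p l'))
    have h3 := hσF (p l) (hpT l)
    have h4 := hσF (p l') (hpT l')
    rw [h1, nd_comm] at h4
    omega
  have h1 := Finset.card_le_mul_card_image Z B hfib
  have h2 : Z.image e ⊆ Fintype.piFinset fun _ =>
      Finset.Icc (-((K * r + c₀ : ℕ) : ℤ)) ((K * r + c₀ : ℕ) : ℤ) := by
    intro i hi
    obtain ⟨l, hl, rfl⟩ := Finset.mem_image.mp hi
    rw [Fintype.mem_piFinset]
    intro u
    have h3 := hlen l
    rw [hZlen l hl] at h3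
    have h4 := natAbs_expoZ_le u (σ (p l))
    rw [Finset.mem_Icc]
    simp only [he]
    omega
  have h3 := Finset.card_le_card h2
  rw [Fintype.card_piFinset, Finset.prod_const, Finset.card_univ, Int.card_Icc] at h3
  have h4 : ((((K * r + c₀ : ℕ) : ℤ) + 1 - -((K * r + c₀ : ℕ) : ℤ)).toNat) ≤
      (2 * K + 2 * c₀ + 1) * (r + 1) := by
    have h5 : ((((K * r + c₀ : ℕ) : ℤ) + 1 - -((K * r + c₀ : ℕ) : ℤ)).toNat) =
      2 * (K * r + c₀) + 1 := by omega
    rw [h5]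
    nlinarith [Nat.zero_le (c₀ * r)]
  have h5 := Nat.mul_le_mul_left B (h3.trans (Nat.pow_le_pow_left h4 _))
  rw [hZcard] at h1
  omega

end Growth

/-! ### Gated subgraphs and cut vertices -/

section Gates

variable {V : Type} {Γ : SimpleGraph V} {S T U I : Set V} {v : V}

/-- `π` retracts the graph onto `S`, collapsing every edge that is not inside `S`. -/
structure IsGate (Γ : SimpleGraph V) (S : Set V) (π : V → V) : Prop where
  mem : ∀ x, π x ∈ S
  fix : ∀ x ∈ S, π x = x
  collapse : ∀ x y, Γ.Adj x y → ¬ (x ∈ S ∧ y ∈ S) → π x = π y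

/-- The subset `S` admits a gate map. -/
def Gated (Γ : SimpleGraph V) (S : Set V) : Prop := ∃ π, IsGate Γ S π

/-- Any two vertices of `S` are joined by a path in `S`. -/
def RchConn (Γ : SimpleGraph V) (S : Set V) : Prop := ∀ a ∈ S, ∀ b ∈ S, Rch Γ S a b

theorem gated_univ : Gated Γ Set.univ :=
  ⟨id, fun _ => trivial, fun _ _ => rfl, fun _ _ _ h => absurd ⟨trivial, trivial⟩ h⟩

theorem rchConn_univ (h : Γ.Connected) : RchConn Γ Set.univ := by
  intro a _ b _
  have := (SimpleGraph.reachable_iff_reflTransGen a b).mp (h a b)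
  exact Relation.ReflTransGen.mono (fun _ _ h => ⟨h, trivial, trivial⟩) _ _ this

open Classical in
theorem IsGate.inter {π : V → V} (h : IsGate Γ S π) (hv : v ∈ S) (hI : ClosedOff Γ v I) :
    IsGate Γ (S ∩ insert v I) fun x => if π x ∈ I then π x else v where
  mem x := by
    split_ifs with hx
    · exact ⟨h.mem x, Or.inr hx⟩
    · exact ⟨hv, Or.inl rfl⟩
  fix := by
    rintro x ⟨hxS, hx⟩
    rw [h.fix x hxS]
    rcases hx with rfl | hx
    · rw [if_neg hI.1]
    · rw [if_pos hx]
  collapse x y hxy hnot := by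
    by_cases hS : x ∈ S ∧ y ∈ S
    · rw [h.fix x hS.1, h.fix y hS.2]
      by_cases hx : x ∈ I <;> by_cases hy : y ∈ I
      · exact absurd ⟨⟨hS.1, Or.inr hx⟩, ⟨hS.2, Or.inr hy⟩⟩ hnot
      · have hyv : y = v := by
          by_contra hyv
          exact hy (hI.2 x hx y hxy hyv)
        exact absurd ⟨⟨hS.1, Or.inr hx⟩, ⟨hS.2, Or.inl hyv⟩⟩ hnot
      · have hxv : x = v := by
          by_contra hxv
          exact hx (hI.2 y hy x hxy.symm hxv)
        exact absurd ⟨⟨hS.1, Or.inl hxv⟩, ⟨hS.2, Or.inr hy⟩⟩ hnot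
      · rw [if_neg hx, if_neg hy]
    · rw [h.collapse x y hxy hS]

theorem RchConn.inter (h : RchConn Γ S) (hv : v ∈ S) (hI : ClosedOff Γ v I) :
    RchConn Γ (S ∩ insert v I) := by
  classical
  set ρ : V → V := fun x => if x ∈ I then x else v with hρ
  have key : ∀ a b, Rch Γ S a b → Rch Γ (S ∩ insert v I) (ρ a) (ρ b) := by
    intro a b hab
    induction hab with
    | refl => exact Relation.ReflTransGen.refl
    | @tail x y _ hxy ih =>
      obtain ⟨hadj, hx, hy⟩ := hxy
      refine ih.trans ?_
      simp only [hρ]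
      by_cases hxI : x ∈ I <;> by_cases hyI : y ∈ I
      · rw [if_pos hxI, if_pos hyI]
        exact Rch.single hadj ⟨hx, Or.inr hxI⟩ ⟨hy, Or.inr hyI⟩
      · rw [if_pos hxI, if_neg hyI]
        have hyv : y = v := by
          by_contra hyv
          exact hyI (hI.2 x hxI y hadj hyv)
        subst hyv
        exact Rch.single hadj ⟨hx, Or.inr hxI⟩ ⟨hy, Or.inl rfl⟩
      · rw [if_neg hxI, if_pos hyI]
        have hxv : x = v := by
          by_contra hxv
          exact hxI (hI.2 y hyI x hadj.symm hxv)
        subst hxv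
        exact Rch.single hadj ⟨hx, Or.inl rfl⟩ ⟨hy, Or.inr hyI⟩
      · rw [if_neg hxI, if_neg hyI]
        exact Relation.ReflTransGen.refl
  have hfix : ∀ x ∈ insert v I, ρ x = x := by
    rintro x (rfl | hx)
    · exact if_neg hI.1
    · exact if_pos hx
  intro a ha b hb
  have := key a b (h a ha.1 b hb.1)
  rwa [hfix a ha.2, hfix b hb.2] at this

theorem Rch.closedOff {a b : V} (hI : ClosedOff Γ v I) (hvU : v ∉ U) (h : Rch Γ U a b)
    (ha : a ∈ I) : b ∈ I := by
  induction h with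
  | refl => exact ha
  | tail _ h ih => exact hI.2 _ ih _ h.1 fun e => hvU (e ▸ h.2.2)

/-- A disconnection of a gated subgraph by a vertex extends to the whole graph. -/
theorem Gated.exists_closedOff (h : Gated Γ S) (hv : v ∈ S) {a b : V} (ha : a ∈ S \ {v})
    (hb : b ∈ S \ {v}) (hab : ¬ Rch Γ (S \ {v}) a b) :
    ∃ I, ClosedOff Γ v I ∧ a ∈ I ∧ b ∈ otherSide v I := by
  obtain ⟨π, hπ⟩ := h
  refine ⟨{x | Rch Γ (S \ {v}) a (π x)}, ⟨fun h => ?_, fun x hx y hxy hyv => ?_⟩, ?_, hb.2,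
    fun h => hab ?_⟩
  · change Rch Γ (S \ {v}) a (π v) at h
    rw [hπ.fix v hv] at h
    exact (h.mem ha).2 rfl
  · change Rch Γ (S \ {v}) a (π y)
    change Rch Γ (S \ {v}) a (π x) at hx
    by_cases hS : x ∈ S ∧ y ∈ S
    · rw [hπ.fix x hS.1] at hx
      rw [hπ.fix y hS.2]
      exact hx.tail ⟨hxy, hx.mem ha, hS.2, hyv⟩
    · rwa [← hπ.collapse x y hxy hS]
  · change Rch Γ (S \ {v}) a (π a)
    rw [hπ.fix a ha.1]
    exact Relation.ReflTransGen.refl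
  · change Rch Γ (S \ {v}) a (π b) at h
    rwa [hπ.fix b hb.1] at h

theorem Biconn.subset_side (hT : Biconn Γ T) (hI : ClosedOff Γ v I) :
    T ⊆ insert v I ∨ T ⊆ insert v (otherSide v I) := by
  by_cases h : ∃ t ∈ T, t ∈ I
  · obtain ⟨t, ht, htI⟩ := h
    left
    intro s hs
    by_cases hsv : s = v
    · exact Or.inl hsv
    · exact Or.inr ((hT.rch_diff v ht (fun e => hI.1 (e ▸ htI)) hs hsv).closedOff hI
        (fun h => h.2 rfl) htI)
  · right
    intro s hs
    by_cases hsv : s = v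
    · exact Or.inl hsv
    · exact Or.inr ⟨hsv, fun hsI => h ⟨s, hs, hsI⟩⟩

theorem IsGate.blocked {π : V → V} (hπ : IsGate Γ S π) {x z : V} (hx : x ∉ S) (hU : π x ∉ U)
    (h : Rch Γ U x z) : z ∉ S ∧ π z = π x := by
  induction h with
  | refl => exact ⟨hx, rfl⟩
  | @tail y z _ hyz ih =>
    have h1 := hπ.collapse y z hyz.1 fun h => ih.1 h.1
    have h2 : π z = π x := h1.symm.trans ih.2
    refine ⟨fun hz => hU ?_, h2⟩
    rw [← h2, hπ.fix z hz]
    exact hyz.2.2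

theorem Gated.subset_of_biconn (hS : Gated Γ S) (hT : Biconn Γ T) {p q : V} (hpq : p ≠ q)
    (hp : p ∈ T ∩ S) (hq : q ∈ T ∩ S) : T ⊆ S := by
  obtain ⟨π, hπ⟩ := hS
  intro x hx
  by_contra hxS
  obtain ⟨t, ht, htx⟩ : ∃ t ∈ T ∩ S, t ≠ π x := by
    by_cases h : p = π x
    · exact ⟨q, hq, fun h' => hpq (h.trans h'.symm)⟩
    · exact ⟨p, hp, h⟩
  have hxπ : x ≠ π x := fun h => hxS (h ▸ hπ.mem x)
  exact (hπ.blocked hxS (fun h => h.2 rfl) (hT.rch_diff (π x) hx hxπ ht.1 htx)).1 ht.2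

theorem Gated.maxBiconn (hS : Gated Γ S) (hb : Biconn Γ S) (hn : S.Nontrivial) :
    MaxBiconn Γ S := by
  refine ⟨hb, fun T hT hST => hST.antisymm ?_⟩
  obtain ⟨p, hp, q, hq, hpq⟩ := hn
  exact hS.subset_of_biconn hT hpq ⟨hST hp, hp⟩ ⟨hST hq, hq⟩

theorem not_cutVertex_iff {x : V} :
    ¬ CutVertex Γ x ↔ ∀ a, a ≠ x → ∀ b, b ≠ x → Rch Γ {u | u ≠ x} a b := by
  rw [CutVertex, not_not, preconnected_induce_iff]
  rfl

theorem Gated.cutVertex (hS : Gated Γ S) {u u' s : V} (hu : u ∈ S) (hu' : u' ∉ S)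
    (hadj : Γ.Adj u u') (hs : s ∈ S) (hsu : s ≠ u) : CutVertex Γ u := by
  obtain ⟨π, hπ⟩ := hS
  by_contra h
  rw [not_cutVertex_iff] at h
  have h1 : π u' = u := by rw [← hπ.collapse u u' hadj fun h => hu' h.2, hπ.fix u hu]
  exact (hπ.blocked hu' (U := {w | w ≠ u}) (fun h => h h1) (h u' hadj.ne' s hsu)).1 hs

/-- A minimal gated connected subset satisfying a condition that is inherited by one of the two
sides of every splitting is biconnected. -/
theorem exists_gated_biconn [Finite V] (hΓ : Γ.Connected) (p : Set V → Prop) (h0 : p Set.univ)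
    (hne : ∀ S, p S → S.Nonempty)
    (hs : ∀ S v I, Gated Γ S → p S → v ∈ S → ClosedOff Γ v I →
      p (S ∩ insert v I) ∨ p (S ∩ insert v (otherSide v I))) :
    ∃ S, Gated Γ S ∧ Biconn Γ S ∧ p S := by
  obtain ⟨S, ⟨hg, hc, hp⟩, hmin⟩ := WellFounded.has_min (wellFounded_lt (α := Set V))
    {S | Gated Γ S ∧ RchConn Γ S ∧ p S} ⟨Set.univ, gated_univ, rchConn_univ hΓ, h0⟩
  refine ⟨S, hg, biconn_iff.mpr ⟨hne S hp, hc, fun v hv a ha b hb => ?_⟩, hp⟩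
  by_contra hab
  obtain ⟨I, hI, haI, hbI⟩ := hg.exists_closedOff hv ha hb hab
  have hinter : ∀ J, ClosedOff Γ v J → p (S ∩ insert v J) → S ⊆ insert v J := by
    intro J hJ hpJ
    by_contra hcon
    refine hmin (S ∩ insert v J) ⟨?_, hc.inter hv hJ, hpJ⟩
      (Set.ssubset_iff_subset_ne.mpr ⟨Set.inter_subset_left, fun h => hcon ?_⟩)
    · obtain ⟨π, hπ⟩ := hg
      exact ⟨_, hπ.inter hv hJ⟩
    · exact Set.inter_eq_left.mp h
  rcases hs S v I hg hp hv hI with h | h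
  · exact (hinter I hI h hb.1).elim hb.2 hbI.2
  · exact (hinter _ hI.other h ha.1).elim ha.2 fun h => h.2 haI

theorem MaxBiconn.gated [Finite V] (hΓ : Γ.Connected) (hT : MaxBiconn Γ T) : Gated Γ T := by
  obtain ⟨S, hg, hb, hTS⟩ := exists_gated_biconn hΓ (fun S => T ⊆ S) (Set.subset_univ T)
    (fun S h => ((biconn_iff.mp hT.1).1).mono h) fun S v I _ h _ hI => by
      rcases hT.1.subset_side hI with h' | h'
      · exact Or.inl (Set.subset_inter h h')
      · exact Or.inr (Set.subset_inter h h')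
  rwa [hT.2 S hb hTS]

theorem exists_exit (hΓ : Γ.Connected) {a b : V} (ha : a ∈ S) (hb : b ∉ S) :
    ∃ x ∈ S, ∃ y, Γ.Adj x y ∧ y ∉ S ∧ Rch Γ S a x := by
  have h := rchConn_univ hΓ a trivial b trivial
  have key : Rch Γ S a b ∨ ∃ x ∈ S, ∃ y, Γ.Adj x y ∧ y ∉ S ∧ Rch Γ S a x := by
    clear hb
    induction h with
    | refl => exact Or.inl Relation.ReflTransGen.refl
    | @tail x y _ hxy ih =>
      rcases ih with ih | ih
      · have hx := ih.mem ha
        by_cases hy : y ∈ S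
        · exact Or.inl (ih.tail ⟨hxy.1, hx, hy⟩)
        · exact Or.inr ⟨x, hx, y, hxy.1, hy, ih⟩
      · exact Or.inr ih
  exact key.resolve_left fun h => hb (h.mem ha)

theorem Biconn.not_cutVertex_of_univ (h : Biconn Γ Set.univ) (x : V) : ¬ CutVertex Γ x := by
  rw [not_cutVertex_iff]
  intro a ha b hb
  exact (h.rch_diff x trivial ha trivial hb).mono fun u hu => hu.2

theorem biconn_univ [Nonempty V] (hΓ : Γ.Connected) (h : ∀ x, ¬ CutVertex Γ x) :
    Biconn Γ Set.univ := by
  refine biconn_iff.mpr ⟨Set.univ_nonempty, rchConn_univ hΓ, fun x _ a ha b hb => ?_⟩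
  exact (not_cutVertex_iff.mp (h x) a ha.2 b hb.2).mono fun u hu => ⟨trivial, hu⟩

theorem Gated.exists_cutVertex [Finite V] (hΓ : Γ.Connected) (hcut : ∃ x, CutVertex Γ x)
    (hT : Gated Γ T) (hb : Biconn Γ T) (hn : T.Nontrivial) : ∃ w ∈ T, CutVertex Γ w := by
  obtain ⟨b, hbT⟩ : ∃ b, b ∉ T := by
    by_contra! h
    obtain ⟨x, hx⟩ := hcut
    rw [← Set.eq_univ_iff_forall] at h
    subst h
    exact hb.not_cutVertex_of_univ x hx
  obtain ⟨a, ha⟩ := hn.nonempty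
  obtain ⟨u, hu, u', huu', hu', _⟩ := exists_exit hΓ ha hbT
  obtain ⟨s, hs, hsu⟩ := hn.exists_ne u
  exact ⟨u, hu, hT.cutVertex hu hu' huu' hs hsu⟩

theorem closedOff_component (v a : V) (hav : a ≠ v) :
    ClosedOff Γ v {x | Rch Γ {u | u ≠ v} a x} :=
  ⟨fun h => h.mem (S := {u | u ≠ v}) hav rfl,
    fun _ hx _ hxy hyv => hx.tail ⟨hxy, hx.mem (S := {u | u ≠ v}) hav, hyv⟩⟩

theorem CutVertex.exists_sides (h : CutVertex Γ v) :
    ∃ I, ClosedOff Γ v I ∧ I.Nonempty ∧ (otherSide v I).Nonempty := by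
  by_contra! hcon
  refine not_cutVertex_iff.mpr (fun a ha b hb => ?_) h
  have h1 := hcon _ (closedOff_component (Γ := Γ) v a ha) ⟨a, Relation.ReflTransGen.refl⟩
  by_contra hab
  exact Set.eq_empty_iff_forall_notMem.mp h1 b ⟨hb, hab⟩

/-- A cut vertex of a biconnected subset separates it from some neighbour of the cut vertex. -/
theorem CutVertex.exists_side_of_biconn (hΓ : Γ.Connected) (h : CutVertex Γ v)
    (hT : Biconn Γ T) {t : V} (ht : t ∈ T) (htv : t ≠ v) :
    ∃ I, ClosedOff Γ v I ∧ (∀ s ∈ T, s ≠ v → s ∈ I) ∧ ∃ w ∈ otherSide v I, Γ.Adj v w := by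
  have hI := closedOff_component (Γ := Γ) v t htv
  refine ⟨_, hI, fun s hs hsv => (hT.rch_diff v ht htv hs hsv).mono fun u hu => hu.2, ?_⟩
  obtain ⟨a, ha, hta⟩ : ∃ a, a ≠ v ∧ ¬ Rch Γ {u | u ≠ v} t a := by
    by_contra! hcon
    exact not_cutVertex_iff.mpr (fun a ha b hb => (hcon a ha).symm.trans (hcon b hb)) h
  obtain ⟨x, hx, y, hxy, hy, hax⟩ := exists_exit hΓ (S := {u | u ≠ v}) (a := a) (b := v) ha
    fun h => h rfl
  have hyv : y = v := by simpa using hy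
  subst hyv
  exact ⟨x, ⟨hx, fun hxI => hta (Rch.trans hxI hax.symm)⟩, hxy.symm⟩

end Gates

/-! ### Images of biconnected subgraphs stay close to biconnected subgraphs -/

section Localization

variable {V W : Type} {Γ : SimpleGraph V} {Λ : SimpleGraph W} {v : V} {I : Set V}
  {A : Set (Raag Λ)} {F : Raag Λ → Raag Γ} {R : ℕ} {g : Raag Γ}

theorem OneSided.other {hI : ClosedOff Γ v I} (h : OneSided hI A F R g) :
    OneSided hI.other A F R g := by
  obtain ⟨ε, hε⟩ := h
  refine ⟨1 - ε, fun x hx hxf => ?_⟩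
  have h1 := hI.col_add_col (g⁻¹ * F x)
  rw [ind_not_mem hxf.not_mem, hε x hx hxf] at h1
  omega

theorem compl_otherSide : (otherSide v I)ᶜ = insert v I := by
  ext u
  simp only [otherSide, Set.mem_compl_iff, Set.mem_ofPred_eq, Set.mem_insert_iff]
  tauto

theorem otherSide_otherSide (hI : ClosedOff Γ v I) : otherSide v (otherSide v I) = I := by
  ext u
  simp only [otherSide, Set.mem_ofPred_eq]
  constructor
  · rintro ⟨h1, h2⟩
    by_contra h3
    exact h2 ⟨h1, h3⟩
  · intro h
    exact ⟨fun e => hI.1 (e ▸ h), fun h' => h'.2 h⟩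

theorem exists_within_of_oneSided [Finite V] (hI : ClosedOff Γ v I) (h1 : (1 : Raag Λ) ∈ A)
    (hR : ∀ g, OneSided hI A F R g) :
    (∃ g R, Within R g (insert v I) F A) ∨
      ∃ g R, Within R g (insert v (otherSide v I)) F A := by
  by_contra! hcon
  set x₀ := F 1 with hx₀
  have hone : ∀ J (hJ : ClosedOff Γ v J), (J = I ∨ J = otherSide v I) →
      ∀ g, OneSided hJ A F R g := by
    rintro J hJ (rfl | rfl) g
    · exact hR g
    · exact (hR g).other
  have hfar : ∀ J, (J = I ∨ J = otherSide v I) → ∀ g, ¬ Within R g (insert v J) F A := by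
    rintro J (rfl | rfl) g
    · exact hcon.1 g R
    · exact hcon.2 g R
  let half : ∀ J, ClosedOff Γ v J → Raag Γ → Set (Raag Γ) :=
    fun J hJ g => {x | hJ.col (g⁻¹ * x) = 1}
  let Q : Set (Set (Raag Γ)) := {H | ∃ g J, ∃ hJ : ClosedOff Γ v J, (J = I ∨ J = otherSide v I) ∧
    nd x₀ g ≤ R ∧ (∀ y ∈ A, FarLine R g v (F y) → F y ∈ half J hJ g) ∧ x₀ ∉ half J hJ g ∧
    H = half J hJ g}
  have hQfin : Q.Finite := by
    refine ((((finite_ball x₀ R).image (half I hI)).union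
      ((finite_ball x₀ R).image (half _ hI.other)))).subset ?_
    rintro H ⟨g, J, hJ, (rfl | rfl), hg, -, -, rfl⟩
    · exact Or.inl ⟨g, hg, rfl⟩
    · exact Or.inr ⟨g, hg, rfl⟩
  have hQne : Q.Nonempty := by
    obtain ⟨ε, hε⟩ := hR x₀
    have h0 : ∀ J (hJ : ClosedOff Γ v J), x₀ ∉ half J hJ x₀ := by
      intro J hJ h
      have h' : hJ.col (x₀⁻¹ * x₀) = 1 := h
      rw [inv_mul_cancel, hJ.col_one] at h'
      exact zero_ne_one h'
    by_cases hε1 : ε = 1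
    · exact ⟨_, x₀, I, hI, Or.inl rfl, (nd_self x₀).trans_le (Nat.zero_le R), fun y hy hyf => (hε y hy hyf).trans hε1,
        h0 _ _, rfl⟩
    · refine ⟨_, x₀, _, hI.other, Or.inr rfl, (nd_self x₀).trans_le (Nat.zero_le R), fun y hy hyf => ?_, h0 _ _, rfl⟩
      refine (hI.col_other hyf.not_mem).mpr ?_
      exact (hI.col_eq _).resolve_right fun h => hε1 ((hε y hy hyf).symm.trans h)
  obtain ⟨H, ⟨g, J, hJ, hJI, -, hpt, hx₀H, rfl⟩, hmin⟩ := hQfin.exists_minimal hQne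
  have hW := hfar J hJI g
  simp only [Within, not_forall, not_exists, not_and, not_le] at hW
  obtain ⟨y, hy, hyfar⟩ := hW
  have hline : lineOf Γ v ≤ subRaag Γ (insert v J) := lineOf_le_subRaag (Or.inl rfl)
  have hvk : ∀ k : ℤ, raagGen Γ v ^ k ∈ lineOf Γ v := fun k => mem_lineOf.mpr ⟨k, rfl⟩
  have hlift : ∀ h ∈ subRaag Γ (insert v J), FarLine R (g * h) v (F y) := by
    intro h hh k
    rw [mul_assoc]
    exact hyfar _ (mul_mem hh (hline (hvk k)))
  have hy1 : hJ.col (g⁻¹ * F y) = 1 := by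
    have := hlift 1 (one_mem _)
    rw [mul_one] at this
    exact hpt y hy this
  have hynot : g⁻¹ * F y ∉ subRaag Γ (otherSide v J)ᶜ := by
    rw [compl_otherSide]
    intro h
    have := hyfar _ h
    rw [mul_inv_cancel_left, nd_self] at this
    omega
  have hJ'I : otherSide v J = I ∨ otherSide v J = otherSide v I := by
    rcases hJI with rfl | rfl
    · exact Or.inr rfl
    · exact Or.inl (otherSide_otherSide hI)
  obtain ⟨h, hh, hhy⟩ := hJ.other.exists_branch hynot
  have hhline : h ∉ lineOf Γ v := by
    intro hl
    rw [hJ.other.col_mul_left (inv_mem hl)] at hhy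
    have h2 := hJ.col_add_col (g⁻¹ * F y)
    have h3 : ind v (g⁻¹ * F y) = 0 := ind_not_mem fun h => hynot (by
      rw [compl_otherSide]; exact hline h)
    omega
  have hhJ : h ∈ subRaag Γ (insert v J) := by rwa [compl_otherSide] at hh
  have hcol : ∀ (k : ℤ) x, hJ.other.col ((g * (h * raagGen Γ v ^ k))⁻¹ * x) =
      hJ.other.col ((g * h)⁻¹ * x) := by
    intro k x
    rw [← hJ.other.col_mul_left (inv_mem (hvk k)) ((g * h)⁻¹ * x)]
    congr 1
    group
  have hpt' : ∀ k : ℤ, ∀ z ∈ A, FarLine R (g * (h * raagGen Γ v ^ k)) v (F z) →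
      hJ.other.col ((g * h)⁻¹ * F z) = 1 := by
    intro k z hz hzf
    obtain ⟨ε, hε⟩ := hone _ hJ.other hJ'I (g * (h * raagGen Γ v ^ k))
    rw [← hcol k, hε z hz hzf, ← hε y hy (hlift _ (mul_mem hhJ (hline (hvk k)))), hcol,
      ← hhy, mul_inv_rev, mul_assoc]
  have hsub : ∀ x, hJ.other.col ((g * h)⁻¹ * x) = 1 → hJ.col (g⁻¹ * x) = 1 := by
    intro x hx
    have h2 := hJ.other.nested hh hhline hx
    have h3 : h * ((g * h)⁻¹ * x) = g⁻¹ * x := by group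
    rw [h3] at h2
    have h4 := hJ.col_add_col (g⁻¹ * x)
    have h5 := hJ.other.col_add_col (g⁻¹ * x)
    omega
  have hnear : ¬ FarLine R (g * h) v x₀ := by
    intro h'
    refine hx₀H (hsub _ (hpt' 0 1 h1 ?_))
    simpa using h'
  obtain ⟨k, hk⟩ := not_farLine.mp hnear
  have hmem : half _ hJ.other (g * (h * raagGen Γ v ^ k)) ∈ Q := by
    refine ⟨_, _, hJ.other, hJ'I, by rwa [← mul_assoc], fun z hz hzf => ?_, fun h' => ?_, rfl⟩
    · exact (hcol k _).trans (hpt' k z hz hzf)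
    · exact hx₀H (hsub _ ((hcol k _).symm.trans h'))
  have hle := hmin hmem fun x hx => hsub x ((hcol k x).symm.trans hx)
  have hin : g * (h * raagGen Γ v ^ k) ∈ half J hJ g := by
    change hJ.col _ = 1
    rw [inv_mul_cancel_left]
    refine hJ.col_insert (mul_mem hhJ (hline (hvk k))) fun h' => hhline ?_
    exact (Subgroup.mul_mem_cancel_right _ (hvk k)).mp h'
  have hout := hle hin
  change hJ.other.col _ = 1 at hout
  rw [inv_mul_cancel, hJ.other.col_one] at hout
  exact zero_ne_one hout

theorem Within.nd_kill_le {S : Set V} (hW : Within R g S F A) :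
    ∀ x ∈ A, nd (F x) (g * kill S (g⁻¹ * F x)) ≤ 2 * R := by
  intro x hx
  obtain ⟨h, hh, hd⟩ := hW x hx
  have h1 := _root_.nd_kill_le S h (g⁻¹ * F x)
  rw [kill_of_mem hh] at h1
  have h2 : nd h (g⁻¹ * F x) = nd (g * h) (F x) := by
    rw [← nd_mul_left g, mul_inv_cancel_left]
  rw [h2, nd_comm, nd_comm (g * h)] at h1
  have h3 := nd_triangle (F x) (g * h) (g * kill S (g⁻¹ * F x))
  rw [nd_mul_left, nd_comm h] at h3
  omega

/-- A nonclique biconnected subgraph has its image close to a gated biconnected subgraph. -/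
theorem Biconn.exists_within [Finite V] [Finite W] (hΓ : Γ.Connected) {T : Set W} {K : ℕ}
    (hT : Biconn Λ T) (hcl : ¬ Λ.IsClique T) (hF : QIEOn K (subRaag Λ T) F) :
    ∃ S, Gated Γ S ∧ Biconn Γ S ∧ ∃ g R, Within R g S F (subRaag Λ T) := by
  refine exists_gated_biconn hΓ (fun S => ∃ g R, Within R g S F (subRaag Λ T)) ?_ ?_ ?_
  · refine ⟨1, 0, fun x _ => ⟨F x, by rw [subRaag_univ]; trivial, ?_⟩⟩
    rw [one_mul, nd_self]
  · rintro S ⟨g, R, hW⟩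
    by_contra h
    rw [Set.not_nonempty_iff_eq_empty] at h
    subst h
    exact hW.not_isClique hF hcl (by simp)
  · rintro S v I - ⟨g, R, hW⟩ - hI
    have hk := hW.nd_kill_le
    set F' : Raag Λ → Raag Γ := fun x => kill S (g⁻¹ * F x) with hF'
    have hFF' : ∀ x ∈ subRaag Λ T, ∀ y ∈ subRaag Λ T,
        nd (F' x) (F' y) ≤ nd (F x) (F y) + 4 * R ∧
        nd (F x) (F y) ≤ nd (F' x) (F' y) + 4 * R := by
      intro x hx y hy
      have h1 := nd_quad (g * F' x) (g * F' y) (F x) (F y)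
      have h2 := nd_quad (F x) (F y) (g * F' x) (g * F' y)
      have h3 : nd (F x) (g * F' x) ≤ 2 * R := hk x hx
      have h4 : nd (F y) (g * F' y) ≤ 2 * R := hk y hy
      rw [nd_mul_left] at h1 h2
      have h5 := nd_comm (F x) (g * F' x)
      have h6 := nd_comm (F y) (g * F' y)
      omega
    have hq : QIEOn (K + 4 * R + 4 * R * K) (subRaag Λ T) F' := by
      intro x hx y hy
      have h1 := hF x hx y hy
      have h2 := hFF' x hx y hy
      constructor
      · nlinarith [Nat.zero_le (R * nd x y), Nat.zero_le (R * K * nd x y), Nat.zero_le (R * K)]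
      · have h3 := Nat.mul_le_mul_left K h2.2
        nlinarith [Nat.zero_le (R * nd (F' x) (F' y)), Nat.zero_le (R * K * nd (F' x) (F' y))]
    have hgo : ∀ J : Set V, (∃ g' R', Within R' g' J F' (subRaag Λ T)) →
        ∃ g' R', Within R' g' (S ∩ J) F (subRaag Λ T) := by
      rintro J ⟨g', R', hW'⟩
      refine ⟨g * kill S g', 2 * R + R', fun x hx => ?_⟩
      obtain ⟨h, hh, hd⟩ := hW' x hx
      refine ⟨kill S h, kill_mem_inter hh, ?_⟩
      have h1 := _root_.nd_kill_le S (F' x) (g' * h)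
      have h4 : kill S (F' x) = F' x := kill_of_mem (kill_mem S _)
      rw [h4, map_mul, ← nd_mul_left g, ← mul_assoc] at h1
      have h2 := nd_triangle (F x) (g * F' x) (g * kill S g' * kill S h)
      have h3 : nd (F x) (g * F' x) ≤ 2 * R := hk x hx
      omega
    obtain ⟨R₀, hR₀⟩ := hT.exists_oneSided hcl hq hI
    exact (exists_within_of_oneSided hI (one_mem _) hR₀).imp (hgo _) (hgo _)

end Localization

/-! ### Coarse inverses and the images of cut vertex lines -/

section Rigidity

variable {V W : Type} {Γ : SimpleGraph V} {Λ : SimpleGraph W} {K : ℕ}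
  {f : Raag Λ → Raag Γ} {f' : Raag Γ → Raag Λ}

/-- The maps `f` and `f'` are mutually coarsely inverse quasi-isometries. -/
structure CoarseInv (K : ℕ) (f : Raag Λ → Raag Γ) (f' : Raag Γ → Raag Λ) : Prop where
  qie : QIEOn K Set.univ f
  qie' : QIEOn K Set.univ f'
  inv : ∀ y, nd (f (f' y)) y ≤ K
  inv' : ∀ x, nd (f' (f x)) x ≤ K

theorem CoarseInv.symm (h : CoarseInv K f f') : CoarseInv K f' f := ⟨h.qie', h.qie, h.inv', h.inv⟩

theorem RaagQI.exists_coarseInv (h : RaagQI Λ Γ) :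
    ∃ (K : ℕ) (f : Raag Λ → Raag Γ) (f' : Raag Γ → Raag Λ), CoarseInv K f f' := by
  obtain ⟨f, k, A, hk, hA, hf, hsurj⟩ := h
  choose f' hf' using hsurj
  simp only [raagDist_eq] at hf hf'
  have hup : ∀ x x', (nd (f x) (f x') : ℝ) ≤ k * nd x x' + A := fun x x' => (hf x x').2
  have hlo : ∀ x x', (nd x x' : ℝ) ≤ k * nd (f x) (f x') + k * A := by
    intro x x'
    have h1 := (hf x x').1
    rw [sub_le_iff_le_add, div_le_iff₀ (by linarith)] at h1
    linarith
  have hkA : 0 ≤ k * A := by positivity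
  have tri : ∀ x y z : Raag Γ, (nd x z : ℝ) ≤ nd x y + nd y z := fun x y z => by
    exact_mod_cast nd_triangle x y z
  have com : ∀ x y : Raag Γ, (nd x y : ℝ) = nd y x := fun x y => by rw [nd_comm]
  obtain ⟨N, hN⟩ := exists_nat_ge (k + 3 * A + 3 * (k * A))
  have fin : ∀ a b : ℕ, (a : ℝ) ≤ k * b + (3 * A + 3 * (k * A)) → a ≤ N * b + N := by
    intro a b hab
    have hb : (0 : ℝ) ≤ b := Nat.cast_nonneg b
    have : (a : ℝ) ≤ ((N * b + N : ℕ) : ℝ) := by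
      push_cast
      nlinarith
    exact_mod_cast this
  refine ⟨N, f, f', fun x _ y _ => ⟨fin _ _ ?_, fin _ _ ?_⟩,
    fun x _ y _ => ⟨fin _ _ ?_, fin _ _ ?_⟩, fun y => ?_, fun x => ?_⟩
  · have := hup x y
    linarith
  · have := hlo x y
    linarith
  · have h1 := hlo (f' x) (f' y)
    have h2 := tri (f (f' x)) x (f (f' y))
    have h3 := tri x y (f (f' y))
    have h4 := hf' x
    have h5 := hf' y
    rw [com] at h5
    have h6 : k * (nd (f (f' x)) (f (f' y)) : ℝ) ≤ k * (A + (nd x y + A)) :=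
      mul_le_mul_of_nonneg_left (by linarith) (by linarith)
    linarith
  · have h1 := hup (f' x) (f' y)
    have h2 := tri x (f (f' x)) y
    have h3 := tri (f (f' x)) (f (f' y)) y
    have h4 := hf' x
    have h5 := hf' y
    rw [com] at h4
    linarith
  · have := fin (nd (f (f' y)) y) 0 (by have := hf' y; push_cast; linarith)
    simpa using this
  · have := fin (nd (f' (f x)) x) 0 (by
      have h1 := hlo (f' (f x)) x
      have h2 : k * (nd (f (f' (f x))) (f x) : ℝ) ≤ k * A :=
        mul_le_mul_of_nonneg_left (hf' _) (by linarith)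
      push_cast
      linarith)
    simpa using this

theorem farLine_mul_zpow {R : ℕ} {x y : Raag Λ} {a b : W} (hab : a ≠ b)
    (hy : expoZ a (x⁻¹ * y) = R + 1) : FarLine R x b y := by
  intro k
  have h := natAbs_expoZ_le a ((x⁻¹ * y)⁻¹ * raagGen Λ b ^ k)
  have e : nd y (x * raagGen Λ b ^ k) = wlen ((x⁻¹ * y)⁻¹ * raagGen Λ b ^ k) := by
    rw [nd, mul_inv_rev, inv_inv, mul_assoc]
  rw [e]
  rw [expoZ_mul, expoZ_inv, hy, expoZ_zpow, expoZ_gen_ne hab.symm] at h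
  simp only [mul_zero, add_zero] at h
  omega

theorem farLine_gen_zpow {R : ℕ} {x : Raag Λ} {a b : W} (hab : a ≠ b) :
    FarLine R x b (x * raagGen Λ a ^ ((R : ℤ) + 1)) := by
  refine farLine_mul_zpow hab ?_
  rw [inv_mul_cancel_left, expoZ_zpow, expoZ_gen_self, mul_one]

theorem CoarseInv.not_oneSided (hf : CoarseInv K f f') {v : V} {I : Set V}
    (hI : ClosedOff Γ v I) (hne : I.Nonempty) (hne' : (otherSide v I).Nonempty) (R : ℕ)
    (g : Raag Γ) : ¬ OneSided hI Set.univ f R g := by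
  rintro ⟨ε, hε⟩
  have key : ∀ a, a ≠ v → hI.col (raagGen Γ a ^ (((R + K : ℕ) : ℤ) + 1)) = ε := by
    intro a hav
    set y := g * raagGen Γ a ^ (((R + K : ℕ) : ℤ) + 1) with hy
    have h1 : FarLine (R + K) g v y := farLine_gen_zpow hav
    have h2 : nd y (f (f' y)) ≤ K := by rw [nd_comm]; exact hf.inv y
    rw [← hε _ trivial (h1.of_near h2), hI.col_eq_of_near (h1.mono (Nat.le_add_left _ _)) h2, hy,
      inv_mul_cancel_left]
  have hnot : ∀ a, a ≠ v → raagGen Γ a ^ (((R + K : ℕ) : ℤ) + 1) ∉ lineOf Γ v := by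
    intro a hav
    have := (farLine_gen_zpow (Λ := Γ) (R := R + K) (x := 1) hav).not_mem
    simpa using this
  obtain ⟨a, ha⟩ := hne
  obtain ⟨b, hb⟩ := hne'
  have hav : a ≠ v := fun e => hI.1 (e ▸ ha)
  have h1 := hI.col_insert (zpow_mem (raagGen_mem_subRaag (T := insert v I) (Or.inr ha)) _) (hnot a hav)
  have h2 := hI.col_compl (zpow_mem (raagGen_mem_subRaag (T := Iᶜ) hb.2)
    (((R + K : ℕ) : ℤ) + 1))
  rw [key a hav] at h1
  rw [key b hb.1] at h2
  omega

theorem commute_of_subset_starSet {u : W} {T : Set W} (hT : T ⊆ starSet Λ u) {x : Raag Λ}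
    (hx : x ∈ subRaag Λ T) : Commute (raagGen Λ u) x := by
  refine subRaag_induction (p := fun x => Commute (raagGen Λ u) x) (Commute.one_right _) ?_ x hx
  intro x _ a ha s hs ih
  refine ih.mul_right ((Letter.gen u).commute hs ?_)
  rcases hT ha with rfl | h
  · exact Or.inr rfl
  · exact Or.inl h

theorem CoarseInv.exists_cutVertex [Finite V] [Finite W] (hf : CoarseInv K f f')
    (hΛ : Λ.Connected) (hcut : ∃ v, CutVertex Γ v) (hcl : ¬ Λ.IsClique Set.univ) :
    ∃ w, CutVertex Λ w := by
  by_contra! hcon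
  have : Nonempty W := hΛ.nonempty
  obtain ⟨v, hv⟩ := hcut
  obtain ⟨I, hI, hne, hne'⟩ := hv.exists_sides
  obtain ⟨R, hR⟩ := (biconn_univ hΛ hcon).exists_oneSided hcl (hf.qie.mono (Set.subset_univ _)) hI
  refine hf.not_oneSided hI hne hne' R 1 ?_
  have := hR 1
  rwa [subRaag_univ, Subgroup.coe_top] at this

theorem CoarseInv.starSet_ne_univ [Finite V] [Finite W] (hf : CoarseInv K f f')
    (hcut : ∃ v, CutVertex Γ v) (hstar : ∀ u : V, starSet Γ u ≠ Set.univ)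
    (hcl : ¬ Λ.IsClique Set.univ) (u : W) : starSet Λ u ≠ Set.univ := by
  intro hu
  obtain ⟨v, hv⟩ := hcut
  obtain ⟨I, hI, hne, hne'⟩ := hv.exists_sides
  obtain ⟨R, hR⟩ := exists_oneSided_of_star (T := Set.univ) (u := u) trivial hu.ge hcl
    (hf.qie.mono (Set.subset_univ _)) hI
  have hnear : ∀ g, ∃ C, ∀ n : ℤ, ∃ k : ℤ, nd (f (raagGen Λ u ^ n)) (g * raagGen Γ v ^ k) ≤ C := by
    intro g
    obtain h | ⟨x, hx, hxn⟩ := hR g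
    · rw [subRaag_univ, Subgroup.coe_top] at h
      exact absurd h (hf.not_oneSided hI hne hne' R g)
    · refine ⟨K * wlen x + K + R, fun n => ?_⟩
      obtain ⟨k, hk⟩ := not_farLine.mp (hxn n)
      refine ⟨k, ?_⟩
      rw [← ((commute_of_subset_starSet hu.ge hx).zpow_left n).eq] at hk
      have h1 := hf.qie.nd_le_of_nd_le (x := raagGen Λ u ^ n) (y := raagGen Λ u ^ n * x)
        trivial trivial (nd_mul_right _ _).le
      have h2 := nd_triangle (f (raagGen Λ u ^ n)) (f (raagGen Λ u ^ n * x))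
        (g * raagGen Γ v ^ k)
      omega
  obtain ⟨s, hs⟩ : ∃ s, s ∉ starSet Γ v := by
    by_contra! h
    exact hstar v (Set.eq_univ_of_forall h)
  have hsv : ¬ Γ.Adj v s := fun h => hs (Or.inr h)
  have hsv' : v ≠ s := fun h => hs (Or.inl h.symm)
  obtain ⟨C₁, h₁⟩ := hnear 1
  obtain ⟨C₂, h₂⟩ := hnear (raagGen Γ s)
  have hbdd : ∀ n : ℤ, nd (f (raagGen Λ u ^ n)) 1 ≤ C₁ + (C₁ + C₂) := by
    intro n
    obtain ⟨k, hk⟩ := h₁ n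
    obtain ⟨m, hm⟩ := h₂ n
    rw [one_mul] at hk
    have h3 := nd_triangle (raagGen Γ v ^ k) (f (raagGen Λ u ^ n)) (raagGen Γ s * raagGen Γ v ^ m)
    rw [nd_comm (raagGen Γ v ^ k) (f _)] at h3
    have h4 := le_wlen_zpow_mul_zpow hsv hsv' (Letter.gen s) (-k) m
    have h5 : nd (raagGen Γ v ^ k) (raagGen Γ s * raagGen Γ v ^ m) =
      wlen (raagGen Γ v ^ (-k) * raagGen Γ s * raagGen Γ v ^ m) := by
      rw [nd, zpow_neg, mul_assoc]
    have h6 := nd_triangle (f (raagGen Λ u ^ n)) (raagGen Γ v ^ k) 1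
    have h7 : nd (raagGen Γ v ^ k) 1 = k.natAbs := by
      rw [nd_comm, nd_one_left, wlen_gen_zpow]
    omega
  set C := C₁ + (C₁ + C₂)
  have h8 := hbdd (K * (C + C) + K + 1 : ℕ)
  have h9 := hbdd 0
  have h10 := nd_triangle (f (raagGen Λ u ^ ((K * (C + C) + K + 1 : ℕ) : ℤ))) 1
    (f (raagGen Λ u ^ (0 : ℤ)))
  rw [nd_comm 1] at h10
  have h11 := hf.qie.nd_le_of_nd_le' (x := raagGen Λ u ^ ((K * (C + C) + K + 1 : ℕ) : ℤ))
    (y := raagGen Λ u ^ (0 : ℤ)) trivial trivial (n := C + C) (by omega)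
  rw [zpow_zero, nd_comm, nd_one_left, wlen_gen_zpow] at h11
  omega

/-- The line of a cut vertex in a biconnected subgraph is mapped close to the line of the centre
of the star containing the image. -/
theorem CoarseInv.exists_near_line [Finite V] [Finite W] (hf : CoarseInv K f f')
    (hΛ : Λ.Connected) {T : Set W} {S : Set V} (hT : Biconn Λ T) (hS : Biconn Γ S)
    (hcl : ¬ Γ.IsClique S) {v : V} (hvS : v ∈ S) (hSv : S ⊆ starSet Γ v)
    (hclosed : ClosedOff Γ v (S \ {v})) {g : Raag Γ} {R₁ : ℕ}
    (hW : Within R₁ g S f (subRaag Λ T)) {w t : W} (hw : CutVertex Λ w) (hwT : w ∈ T)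
    (htT : t ∈ T) (htw : t ≠ w) {x : Raag Λ} (hx : x ∈ subRaag Λ T) :
    ∃ R, ∀ n : ℤ, ∃ k : ℤ, nd (f (x * raagGen Λ w ^ n)) (g * raagGen Γ v ^ k) ≤ R := by
  obtain ⟨I, hI, hTI, w', hw'I, hadj⟩ := hw.exists_side_of_biconn hΛ hT htT htw
  have hZ : QIEOn K (subRaag Γ S) fun h => f' (g * h) := by
    intro a _ b _
    have := hf.qie' (g * a) trivial (g * b) trivial
    rwa [nd_mul_left] at this
  obtain ⟨R₀, hR₀⟩ := hS.exists_oneSided hcl hZ hI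
  -- Far from the line, the image of the coset under the inverse lies on the side of `t`.
  have hside : ∀ h ∈ subRaag Γ S, FarLine R₀ x w (f' (g * h)) →
      hI.col (x⁻¹ * f' (g * h)) = 1 := by
    obtain ⟨ε, hε⟩ := hR₀ x
    set D := K * R₁ + K + K with hD
    set y := x * raagGen Λ t ^ (((R₀ + D : ℕ) : ℤ) + 1) with hy
    have hyT : y ∈ subRaag Λ T := mul_mem hx (zpow_mem (raagGen_mem_subRaag htT) _)
    obtain ⟨h₀, hh₀, hd⟩ := hW y hyT
    have hnear : nd y (f' (g * h₀)) ≤ D := by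
      have h1 := hf.qie'.nd_le_of_nd_le (x := f y) (y := g * h₀) trivial trivial hd
      have h2 := hf.inv' y
      have h3 := nd_triangle y (f' (f y)) (f' (g * h₀))
      rw [nd_comm] at h2
      omega
    have hyfar : FarLine (R₀ + D) x w y := farLine_gen_zpow htw
    have h1 := hI.col_eq_of_near (hyfar.mono (Nat.le_add_left D R₀)) hnear
    have h2 : hI.col (x⁻¹ * y) = 1 := by
      refine hI.col_insert ?_ hyfar.not_mem
      rw [hy, inv_mul_cancel_left]
      exact zpow_mem (raagGen_mem_subRaag (T := insert w I) (Or.inr (hTI t htT htw))) _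
    have h3 : hI.col (x⁻¹ * f' (g * h₀)) = ε := hε h₀ hh₀ (hyfar.of_near hnear)
    intro h hh hfar
    have h4 : hI.col (x⁻¹ * f' (g * h)) = ε := hε h hh hfar
    rw [h4, ← h3, h1, h2]
  set E := 2 * K with hE
  set m := R₀ + (K * E + 2 * K) with hm
  set q : ℤ → Raag Λ := fun n => x * raagGen Λ w ^ n * raagGen Λ w' ^ ((m : ℤ) + 1) with hq
  have hw'w : w' ≠ w := hw'I.1
  have hcomm : ∀ n k : ℤ, Commute (raagGen Λ w ^ n) (raagGen Λ w' ^ k) := fun n k =>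
    (((Letter.gen w).commute (Letter.gen w') (Or.inl hadj)).zpow_left n).zpow_right k
  have hqfar : ∀ n, FarLine m x w (q n) := by
    intro n
    refine farLine_mul_zpow hw'w ?_
    rw [hq]
    simp only
    rw [mul_assoc, inv_mul_cancel_left, expoZ_mul, expoZ_zpow, expoZ_zpow, expoZ_gen_self,
      expoZ_gen_ne hw'w.symm]
    ring
  have hqcol : ∀ n, hI.col (x⁻¹ * q n) = 0 := by
    intro n
    refine hI.col_compl ?_
    rw [hq]
    simp only
    rw [mul_assoc, inv_mul_cancel_left]
    exact mul_mem (zpow_mem (raagGen_mem_subRaag (T := Iᶜ) hI.1) _)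
      (zpow_mem (raagGen_mem_subRaag (T := Iᶜ) hw'I.2) _)
  have hqS : ∀ n, ∀ h ∈ subRaag Γ S, E < nd (f (q n)) (g * h) := by
    intro n h hh
    by_contra! hcon
    have h1 := hf.qie'.nd_le_of_nd_le (x := f (q n)) (y := g * h) trivial trivial hcon
    have h2 := hf.inv' (q n)
    have h3 := nd_triangle (q n) (f' (f (q n))) (f' (g * h))
    rw [nd_comm] at h2
    have h4 : nd (q n) (f' (g * h)) ≤ K * E + 2 * K := by omega
    have h5 := hI.col_eq_of_near ((hqfar n).mono (Nat.le_add_left _ R₀)) h4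
    rw [hside h hh ((hqfar n).of_near h4), hqcol n] at h5
    exact one_ne_zero h5
  have hqstep : ∀ n, nd (f (q n)) (f (q (n + 1))) ≤ E := by
    intro n
    have h1 : q (n + 1) = q n * raagGen Λ w := by
      have := (hcomm 1 ((m : ℤ) + 1)).eq
      rw [zpow_one] at this
      rw [hq]
      simp only
      rw [zpow_add_one, ← mul_assoc, mul_assoc _ (raagGen Λ w), this, ← mul_assoc]
    rw [h1]
    have := hf.qie.nd_le_of_nd_le (x := q n) (y := q n * raagGen Λ w) trivial trivial
      (nd_letter (Letter.gen w) _)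
    omega
  have hJc : (otherSide v (S \ {v}))ᶜ = S := by
    rw [compl_otherSide, Set.insert_sdiff_singleton, Set.insert_eq_of_mem hvS]
  have hbranch : g⁻¹ * f (q 0) ∉ subRaag Γ (otherSide v (S \ {v}))ᶜ := by
    rw [hJc]
    intro h
    have := hqS 0 _ h
    rw [mul_inv_cancel_left, nd_self] at this
    omega
  obtain ⟨h, hh, hcol⟩ := hclosed.other.exists_branch hbranch
  rw [hJc] at hh
  have hvk : ∀ k : ℤ, raagGen Γ v ^ k ∈ subRaag Γ S := fun k =>
    zpow_mem (raagGen_mem_subRaag hvS) k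
  have hfarS : ∀ n, FarLine E (g * h) v (f (q n)) := by
    intro n k
    rw [mul_assoc]
    exact hqS n _ (mul_mem hh (hvk k))
  have hcoln : ∀ n : ℤ, hclosed.other.col ((g * h)⁻¹ * f (q n)) = 1 := by
    intro n
    induction n using Int.induction_on with
    | zero => rw [mul_inv_rev, mul_assoc]; exact hcol
    | succ n ih => exact (hclosed.other.col_eq_of_near (hfarS n) (hqstep n)).trans ih
    | pred n ih =>
      have h1 := hclosed.other.col_eq_of_near (hfarS (-(n : ℤ) - 1)) (hqstep (-(n : ℤ) - 1))
      rw [sub_add_cancel] at h1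
      exact h1.symm.trans ih
  set L := K * (m + 1) + K + R₁ with hL
  refine ⟨K * (m + 1) + K + L + wlen h, fun n => ?_⟩
  set y := x * raagGen Λ w ^ n with hy
  have hyT : y ∈ subRaag Λ T := mul_mem hx (zpow_mem (raagGen_mem_subRaag hwT) _)
  obtain ⟨p, hp, hd⟩ := hW y hyT
  have hyq : nd (f y) (f (q n)) ≤ K * (m + 1) + K := by
    refine hf.qie.nd_le_of_nd_le trivial trivial ?_
    rw [hq]
    simp only
    rw [nd_mul_right, wlen_gen_zpow]
    omega
  have hnear : ¬ FarLine L (g * h) v (f (q n)) := by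
    intro hfar
    have h1 : nd (f (q n)) (g * p) ≤ L := by
      have := nd_triangle (f (q n)) (f y) (g * p)
      rw [nd_comm] at hyq
      omega
    have h2 := hclosed.other.col_eq_of_near hfar h1
    have h3 : (g * h)⁻¹ * (g * p) = h⁻¹ * p := by group
    rw [hcoln n, h3, hclosed.other.col_compl (by rw [hJc]; exact mul_mem (inv_mem hh) hp)] at h2
    exact zero_ne_one h2
  obtain ⟨k, hk⟩ := not_farLine.mp hnear
  refine ⟨k, ?_⟩
  have h1 : g * h * raagGen Γ v ^ k = g * raagGen Γ v ^ k * h := by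
    rw [mul_assoc, mul_assoc, ((commute_of_subset_starSet hSv hh).zpow_left k).eq]
  have h2 := nd_mul_right (g * raagGen Γ v ^ k) h
  rw [h1] at hk
  have h3 := nd_quad (f y) (g * raagGen Γ v ^ k) (f (q n)) (g * raagGen Γ v ^ k * h)
  omega

theorem Gated.mem_of_subset_starSet {S : Set V} (hS : Gated Γ S) (hn : S.Nontrivial) {v : V}
    (hSv : S ⊆ starSet Γ v) : v ∈ S := by
  obtain ⟨π, hπ⟩ := hS
  obtain ⟨a, ha, b, hb, hab⟩ := hn
  by_contra hv
  have key : ∀ c ∈ S, π v = c := by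
    intro c hc
    rcases hSv hc with rfl | h
    · exact absurd hc hv
    · rw [hπ.collapse v c h fun h => hv h.1, hπ.fix c hc]
  exact hab ((key a ha).symm.trans (key b hb))

theorem nontrivial_of_not_isClique {S : Set V} (h : ¬ Γ.IsClique S) : S.Nontrivial := by
  by_contra h'
  exact h ((Set.not_nontrivial_iff.mp h').pairwise _)

theorem CoarseInv.isClique [Finite V] [Finite W] (hf : CoarseInv K f f')
    (hΓ : Γ.Connected) (hΛ : Λ.Connected) (hclique : ∀ S ∈ C1 Γ, Γ.IsClique S)
    (hcut : ∃ w, CutVertex Λ w) {T : Set W} (hT : T ∈ C1 Λ) : Λ.IsClique T := by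
  by_contra hcl
  obtain ⟨hmax, hC⟩ := hT
  have hq : QIEOn K (subRaag Λ T) f := hf.qie.mono (Set.subset_univ _)
  obtain ⟨S, hSg, hSb, g, R, hW⟩ := hmax.1.exists_within hΓ hcl hq
  have hScl := hW.not_isClique hq hcl
  have hSn := nontrivial_of_not_isClique hScl
  have hSC : S ∉ C1 Γ := fun h => hScl (hclique S h)
  simp only [C1, Set.mem_ofPred_eq, not_and_or, not_or] at hSC
  obtain ⟨h1, h2⟩ := hSC.resolve_left fun h => h (hSg.maxBiconn hSb hSn)
  push Not at h1 h2
  obtain ⟨v, hv, hSv⟩ := h2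
  have hvS := hSg.mem_of_subset_starSet hSn hSv
  have hclosed : ClosedOff Γ v (S \ {v}) := by
    refine ⟨fun h => h.2 rfl, fun x hx y hxy hyv => ⟨?_, hyv⟩⟩
    by_contra hyS
    exact h1 x hx.1 v hvS hx.2 (hSg.cutVertex hx.1 hyS hxy hvS (Ne.symm hx.2)) hv
  have hnear : ∀ w ∈ T, CutVertex Λ w → ∀ t ∈ T, t ≠ w → ∀ x ∈ subRaag Λ T,
      ∃ R, ∀ n : ℤ, ∃ k : ℤ, nd (f (x * raagGen Λ w ^ n)) (g * raagGen Γ v ^ k) ≤ R :=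
    fun w hwT hw t htT htw x hx =>
      hf.exists_near_line hΛ hmax.1 hSb hScl hvS hSv hclosed hW hw hwT htT htw hx
  rcases hC with ⟨w, hwT, w', hw'T, hne, hw, hw'⟩ | hstar
  · obtain ⟨R₁, h₁⟩ := hnear w hwT hw w' hw'T hne.symm 1 (one_mem _)
    obtain ⟨R₂, h₂⟩ := hnear w' hw'T hw' w hwT hne 1 (one_mem _)
    refine false_of_two_labels hf.qie (g := g) (v := v) (x := 1) (x' := 1) (R := max R₁ R₂) hne
      (fun _ => trivial) (fun _ => trivial) (fun n => ?_) (fun n => ?_)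
    · exact (h₁ n).imp fun k hk => hk.trans (le_max_left _ _)
    · exact (h₂ n).imp fun k hk => hk.trans (le_max_right _ _)
  · obtain ⟨w, hwT, hw⟩ := (hmax.gated hΛ).exists_cutVertex hΛ hcut hmax.1
      (nontrivial_of_not_isClique hcl)
    obtain ⟨t, htT, ht⟩ := Set.not_subset.mp (hstar w hw)
    have htw : t ≠ w := fun h => ht (Or.inl h)
    have hadj : ¬ Λ.Adj w t := fun h => ht (Or.inr h)
    obtain ⟨R₁, h₁⟩ := hnear w hwT hw t htT htw 1 (one_mem _)
    obtain ⟨R₂, h₂⟩ := hnear w hwT hw t htT htw (raagGen Λ t) (raagGen_mem_subRaag htT)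
    refine false_of_line_and_ray hf.qie (g := g) (v := v) (x := 1) (x' := raagGen Λ t) (b := w)
      (b' := w) (R := max R₁ R₂) (c := 0) (fun _ => trivial) (fun _ => trivial) (fun n m => ?_) (fun n => ?_) (fun n => ?_)
    rotate_left
    · exact (h₁ n).imp fun k hk => hk.trans (le_max_left _ _)
    · exact (h₂ n).imp fun k hk => hk.trans (le_max_right _ _)
    · have h3 := le_wlen_zpow_mul_zpow hadj htw.symm (Letter.gen t) (-n) m
      rw [Int.natAbs_neg, zpow_neg, mul_assoc] at h3
      rw [one_mul, nd]
      exact h3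

end Rigidity

/-- If `A(Γ)` has a visual JSJ tree-of-cylinders decomposition with
free-abelian rigid vertex groups (every member of `C₁` is a clique), then so does any
RAAG quasi-isometric to it. -/
theorem stmt2 {V W : Type} [Fintype V] [Fintype W]
    (Γ : SimpleGraph V) (Λ : SimpleGraph W)
    (hΓconn : Γ.Connected) (hΛconn : Λ.Connected)
    (hVcard : 2 ≤ Fintype.card V) (hWcard : 2 ≤ Fintype.card W)
    (hcut : ∃ x : V, CutVertex Γ x)
    (hstar : ∀ u : V, starSet Γ u ≠ Set.univ)
    (hclique : ∀ S ∈ C1 Γ, Γ.IsClique S)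
    (hqi : RaagQI Γ Λ) :
    (∃ x : W, CutVertex Λ x) ∧ (∀ u : W, starSet Λ u ≠ Set.univ) ∧
      (∀ T ∈ C1 Λ, Λ.IsClique T) := by
  obtain ⟨K, f', f, hf'⟩ := hqi.exists_coarseInv
  have hf := hf'.symm
  have hΓcl : ¬ Γ.IsClique Set.univ := by
    intro h
    obtain ⟨u⟩ := hΓconn.nonempty
    refine hstar u (Set.eq_univ_of_forall fun a => ?_)
    by_cases hau : a = u
    · exact Or.inl hau
    · exact Or.inr (h trivial trivial (Ne.symm hau))
  have hΛcl : ¬ Λ.IsClique Set.univ := by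
    have hW : Within 0 1 Set.univ f' (subRaag Γ Set.univ) := fun x _ =>
      ⟨f' x, by rw [subRaag_univ]; trivial, by rw [one_mul, nd_self]⟩
    exact hW.not_isClique (hf'.qie.mono (Set.subset_univ _)) hΓcl
  have hΛcut := hf.exists_cutVertex hΛconn hcut hΛcl
  exact ⟨hΛcut, hf.starSet_ne_univ hcut hstar hΛcl,
    fun T hT => hf.isClique hΓconn hΛconn hclique hΛcut hT⟩

end
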